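/- Let P, Q ∈ SYT(r×c), n = rc, S = stack(P,Q). Let x_{ij} denote the entry in row i, column j of Q and y_{ij} the entry in row i, column j of ∂(P). Then for all 1 ≤ s, t ≤ r and 1 ≤ j ≤ c, the entry of PM(S)^NE at Cartesian coordinates (x_{sj}, y_{tj}) equals s+t−1; moreover every nonzero entry of PM(S)^NE occurs at such a position. -/

import Mathlib

namespace PromRS

/-! ## Rectangular standard Young tableaux (as functions; 0-indexed cells; entries 1..R*C) -/

/-- `T` is a standard Young tableau of rectangular shape with `R` rows and `C` columns:
rows and columns strictly increase, and the entries on the `R × C` rectangle are a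
bijection onto `{1, …, R*C}`. -/
def IsSYT (R C : ℕ) (T : ℕ → ℕ → ℕ) : Prop :=
  (∀ i j, i < R → j + 1 < C → T i j < T i (j + 1)) ∧
  (∀ i j, i + 1 < R → j < C → T i j < T (i + 1) j) ∧
  Set.BijOn (fun p : ℕ × ℕ => T p.1 p.2) {p : ℕ × ℕ | p.1 < R ∧ p.2 < C} (Set.Icc 1 (R * C))

/-- Stacking: add `r*c` to every entry of `Q` and place the result below `P`. -/
def stack (r c : ℕ) (P Q : ℕ → ℕ → ℕ) : ℕ → ℕ → ℕ := fun i j =>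
  if i < r then P i j else Q (i - r) j + r * c

/-! ## Gromotion and promotion permutations -/

/-- Value of `T` at a cell, with `⊤` outside the `R × C` rectangle. -/
def ext (R C : ℕ) (T : ℕ → ℕ → ℕ) (p : ℕ × ℕ) : WithTop ℕ :=
  if p.1 < R ∧ p.2 < C then ((T p.1 p.2 : ℕ) : WithTop ℕ) else ⊤

/-- The jeu de taquin slide moves the empty cell to the smaller of its east/south neighbors. -/
def nextCell (R C : ℕ) (T : ℕ → ℕ → ℕ) (p : ℕ × ℕ) : ℕ × ℕ :=
  if ext R C T (p.1, p.2 + 1) < ext R C T (p.1 + 1, p.2) then (p.1, p.2 + 1)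
  else (p.1 + 1, p.2)

/-- The sliding path of the empty cell, starting at the top-left corner. -/
def slidePath (R C : ℕ) (T : ℕ → ℕ → ℕ) : ℕ → ℕ × ℕ
  | 0 => (0, 0)
  | k + 1 => nextCell R C T (slidePath R C T k)

def maxEntry (R C : ℕ) (T : ℕ → ℕ → ℕ) : ℕ :=
  ((Finset.range R) ×ˢ (Finset.range C)).sup fun p => T p.1 p.2

/-- Gromotion: delete the minimal entry (at the top-left corner), rectify by jeu de taquin
slides, and fill the vacated outer corner with (current maximum) + 1; entries are not
decremented. -/
def gromotion (R C : ℕ) (T : ℕ → ℕ → ℕ) : ℕ → ℕ → ℕ := fun i j =>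
  if i = R - 1 ∧ j = C - 1 then maxEntry R C T + 1
  else
    match (List.range (R + C - 2)).find? (fun k => decide (slidePath R C T k = (i, j))) with
    | some k => T (slidePath R C T (k + 1)).1 (slidePath R C T (k + 1)).2
    | none => T i j

/-- The entry that slides (up) into row `i` (1-indexed) during one gromotion slide of `T`:
the value of `T` at the first cell of the sliding path lying in 0-indexed row `i`. -/
def slideInto (R C : ℕ) (T : ℕ → ℕ → ℕ) (i : ℕ) : ℕ :=
  match (List.range (R + C - 1)).find? (fun k => decide ((slidePath R C T k).1 = i)) with
  | some k => T (slidePath R C T k).1 (slidePath R C T k).2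
  | none => 0

/-- The `i`-th promotion permutation of `T ∈ SYT(R × C)`: its value at `j` is the entry
that slides into row `i` when computing `gromotion^j(T)`, taken modulo `R*C` with
residues in `{1, …, R*C}`. -/
def promPerm (R C : ℕ) (T : ℕ → ℕ → ℕ) (i : ℕ) : ℕ → ℕ := fun j =>
  (slideInto R C ((gromotion R C)^[j - 1] T) i - 1) % (R * C) + 1

/-! ## Tableaux as lists of rows, Robinson–Schensted insertion -/

/-- Entry of a list-of-rows tableau (0-indexed; `0` outside). -/
def entryL (T : List (List ℕ)) (i j : ℕ) : ℕ := (T.getD i []).getD j 0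

/-- Convert a function tableau on an `R × C` rectangle to a list of rows. -/
def toListT (R C : ℕ) (T : ℕ → ℕ → ℕ) : List (List ℕ) :=
  (List.range R).map fun i => (List.range C).map fun j => T i j

/-- Transpose (conjugate) of a list-of-rows tableau. -/
def transposeT (T : List (List ℕ)) : List (List ℕ) :=
  (List.range (T.getD 0 []).length).map fun j => T.filterMap fun row => row[j]?

/-- Shape (row lengths) of a list-of-rows tableau. -/
def shapeL (T : List (List ℕ)) : List ℕ := T.map List.length

/-- Standard Young tableau, as a list of rows: weakly decreasing nonempty row lengths,
rows and columns strictly increasing, and entries exactly `{1, …, N}` where `N` is the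
number of cells. -/
def IsSYTList (T : List (List ℕ)) : Prop :=
  (∀ i, i + 1 < T.length → (T.getD (i + 1) []).length ≤ (T.getD i []).length) ∧
  (∀ row ∈ T, row ≠ []) ∧
  (∀ i j, i < T.length → j + 1 < (T.getD i []).length → entryL T i j < entryL T i (j + 1)) ∧
  (∀ i j, i + 1 < T.length → j < (T.getD (i + 1) []).length →
    entryL T i j < entryL T (i + 1) j) ∧
  T.flatten.Nodup ∧ (∀ m, m ∈ T.flatten ↔ 1 ≤ m ∧ m ≤ T.flatten.length)

/-- Schensted row insertion of `x` into a tableau. -/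
def rowInsert : List (List ℕ) → ℕ → List (List ℕ)
  | [], x => [[x]]
  | r :: rs, x =>
    match r.dropWhile (fun y => decide (y < x)) with
    | [] => (r ++ [x]) :: rs
    | y :: bs => (r.takeWhile (fun y => decide (y < x)) ++ x :: bs) :: rowInsert rs y

/-- The (0-indexed) row where the shape grew when passing from `P` to `P'`. -/
def rowOfNewCell (P P' : List (List ℕ)) : ℕ :=
  ((List.range P'.length).find? fun i =>
    decide ((P'.getD i []).length ≠ (P.getD i []).length)).getD 0

def placeInRow (Q : List (List ℕ)) (r k : ℕ) : List (List ℕ) :=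
  if r < Q.length then Q.set r (Q.getD r [] ++ [k]) else Q ++ [[k]]

/-- The Robinson–Schensted correspondence: the pair (insertion tableau, recording tableau)
of a word. -/
def RS (w : List ℕ) : List (List ℕ) × List (List ℕ) :=
  (List.range w.length).foldl
    (fun PQ i =>
      let P' := rowInsert PQ.1 (w.getD i 0)
      (P', placeInRow PQ.2 (rowOfNewCell PQ.1 P') (i + 1)))
    ([], [])

/-! ## Jeu de taquin on list tableaux; evacuation -/

def extL (T : List (List ℕ)) (p : ℕ × ℕ) : WithTop ℕ :=
  if p.2 < (T.getD p.1 []).length then ((entryL T p.1 p.2 : ℕ) : WithTop ℕ) else ⊤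

def nextCellL (T : List (List ℕ)) (p : ℕ × ℕ) : ℕ × ℕ :=
  if extL T (p.1, p.2 + 1) = ⊤ ∧ extL T (p.1 + 1, p.2) = ⊤ then p
  else if extL T (p.1, p.2 + 1) < extL T (p.1 + 1, p.2) then (p.1, p.2 + 1)
  else (p.1 + 1, p.2)

def jdtPath (T : List (List ℕ)) : ℕ → ℕ × ℕ
  | 0 => (0, 0)
  | k + 1 => nextCellL T (jdtPath T k)

/-- The outer corner vacated when the minimal entry of `T` is deleted and the tableau is
rectified by jeu de taquin slides. -/
def vacated (T : List (List ℕ)) : ℕ × ℕ := jdtPath T T.flatten.length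

/-- The value at cell `(i, j)` after the rectification slide. -/
def slidValue (T : List (List ℕ)) (i j : ℕ) : ℕ :=
  match (List.range T.flatten.length).find? (fun k =>
      decide (jdtPath T k = (i, j) ∧ jdtPath T (k + 1) ≠ (i, j))) with
  | some k => entryL T (jdtPath T (k + 1)).1 (jdtPath T (k + 1)).2
  | none => entryL T i j

/-- Delete the minimal entry of `T` and rectify. -/
def delta (T : List (List ℕ)) : List (List ℕ) :=
  ((List.range T.length).map fun i =>
    (List.range ((T.getD i []).length - if i = (vacated T).1 then 1 else 0)).map fun j =>
      slidValue T i j).filter fun row => decide (row ≠ [])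

/-- The entry of the evacuation `∂T` at cell `(i,j)`: `n + 1 - k` where the `k`-th
deletion-rectification vacates `(i,j)`. -/
def evacEntry (T : List (List ℕ)) (i j : ℕ) : ℕ :=
  match (List.range T.flatten.length).find? (fun k =>
      decide (vacated (delta^[k] T) = (i, j))) with
  | some k => T.flatten.length - k
  | none => 0

/-- Schützenberger evacuation `∂T` of a standard Young tableau. -/
def evacL (T : List (List ℕ)) : List (List ℕ) :=
  (List.range T.length).map fun i =>
    (List.range (T.getD i []).length).map fun j => evacEntry T i j

/-! ## Shadow lines, skeleta, and Viennot's construction -/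

def dirNE (a b : ℤ × ℤ) : Prop := a.1 ≤ b.1 ∧ a.2 ≤ b.2
def dirSE (a b : ℤ × ℤ) : Prop := a.1 ≤ b.1 ∧ b.2 ≤ a.2
def dirSW (a b : ℤ × ℤ) : Prop := b.1 ≤ a.1 ∧ b.2 ≤ a.2
def dirNW (a b : ℤ × ℤ) : Prop := b.1 ≤ a.1 ∧ a.2 ≤ b.2

def minimalsUnder (d : ℤ × ℤ → ℤ × ℤ → Prop) (P : Set (ℤ × ℤ)) : Set (ℤ × ℤ) :=
  {p ∈ P | ∀ q ∈ P, d q p → q = p}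

/-- `P` minus its first `j` shadow lines. -/
def shadowRest (d : ℤ × ℤ → ℤ × ℤ → Prop) (P : Set (ℤ × ℤ)) : ℕ → Set (ℤ × ℤ)
  | 0 => P
  | j + 1 => shadowRest d P j \ minimalsUnder d (shadowRest d P j)

/-- The `j`-th shadow line of `P` (1-indexed `j`). -/
def shadowLine (d : ℤ × ℤ → ℤ × ℤ → Prop) (P : Set (ℤ × ℤ)) (j : ℕ) : Set (ℤ × ℤ) :=
  minimalsUnder d (shadowRest d P (j - 1))

/-- The skeleton of a single shadow line `L`: the minimal elements of the set of points
covered by the shadows of at least two points of `L`. -/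
def lineSkeleton (d : ℤ × ℤ → ℤ × ℤ → Prop) (L : Set (ℤ × ℤ)) : Set (ℤ × ℤ) :=
  minimalsUnder d {x | ∃ p ∈ L, ∃ q ∈ L, p ≠ q ∧ d p x ∧ d q x}

/-- The skeleton of `P`: the union of the skeleta of its shadow lines. -/
def skeleton (d : ℤ × ℤ → ℤ × ℤ → Prop) (P : Set (ℤ × ℤ)) : Set (ℤ × ℤ) :=
  ⋃ j : ℕ, lineSkeleton d (shadowLine d P (j + 1))

/-- The `k`-th iterated skeleton of `P`. -/
def skeletonIter (d : ℤ × ℤ → ℤ × ℤ → Prop) (P : Set (ℤ × ℤ)) (k : ℕ) : Set (ℤ × ℤ) :=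
  (skeleton d)^[k] P

def IsMinSnd (L : Set (ℤ × ℤ)) (y : ℤ) : Prop := (∃ p ∈ L, p.2 = y) ∧ ∀ p ∈ L, y ≤ p.2
def IsMaxSnd (L : Set (ℤ × ℤ)) (y : ℤ) : Prop := (∃ p ∈ L, p.2 = y) ∧ ∀ p ∈ L, p.2 ≤ y
def IsMinFst (L : Set (ℤ × ℤ)) (x : ℤ) : Prop := (∃ p ∈ L, p.1 = x) ∧ ∀ p ∈ L, x ≤ p.1
def IsMaxFst (L : Set (ℤ × ℤ)) (x : ℤ) : Prop := (∃ p ∈ L, p.1 = x) ∧ ∀ p ∈ L, p.1 ≤ x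

/-- The set of exit coordinates (specified by `spec`) of the shadow lines of the `i`-th
iterated skeleton of `P` in direction `d`. -/
def exitSet (spec : Set (ℤ × ℤ) → ℤ → Prop) (d : ℤ × ℤ → ℤ × ℤ → Prop)
    (P : Set (ℤ × ℤ)) (i : ℕ) : Set ℤ :=
  {v | ∃ j : ℕ, spec (shadowLine d (skeletonIter d P i) (j + 1)) v}

/-- The word read off along one edge in Viennot's construction is the lattice word of the
standard tableau `T`: there is an enumeration `e` of all shadow-line exit coordinates,
in the order prescribed by `lt`, such that the `m`-th exit belongs to a shadow line of the
`i`-th iterated skeleton exactly when the entry `m` of `T` lies in row `i + 1`. -/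
def ReadsWord (spec : Set (ℤ × ℤ) → ℤ → Prop) (lt : ℤ → ℤ → Prop)
    (d : ℤ × ℤ → ℤ × ℤ → Prop) (P : Set (ℤ × ℤ)) (T : List (List ℕ)) : Prop :=
  ∃ e : Fin T.flatten.length → ℤ,
    (∀ a b : Fin T.flatten.length, a < b → lt (e a) (e b)) ∧
    (Set.range e = ⋃ i : ℕ, exitSet spec d P i) ∧
    ∀ (m : Fin T.flatten.length) (i : ℕ), e m ∈ exitSet spec d P i →
      (T.findIdx fun row => row.contains (m.1 + 1)) + 1 = i + 1

/-- `𝒱(𝒫, ↗) = (Pt, Qt)`: the P-word is read bottom-to-top along the right edge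
(east exit heights, which are the minimal `y`-coordinates of the lines), the Q-word
left-to-right along the top edge (north exits at minimal `x`-coordinates). -/
def ViennotNE (P : Set (ℤ × ℤ)) (Pt Qt : List (List ℕ)) : Prop :=
  ReadsWord IsMinSnd (· < ·) dirNE P Pt ∧ ReadsWord IsMinFst (· < ·) dirNE P Qt

/-- `𝒱(𝒫, ↘) = (Pt, Qt)`: P-word left-to-right along the bottom edge, Q-word
top-to-bottom along the right edge. -/
def ViennotSE (P : Set (ℤ × ℤ)) (Pt Qt : List (List ℕ)) : Prop :=
  ReadsWord IsMinFst (· < ·) dirSE P Pt ∧ ReadsWord IsMaxSnd (· > ·) dirSE P Qt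

/-- `𝒱(𝒫, ↙) = (Pt, Qt)`: P-word bottom-to-top along the left edge, Q-word
right-to-left along the bottom edge. -/
def ViennotSW (P : Set (ℤ × ℤ)) (Pt Qt : List (List ℕ)) : Prop :=
  ReadsWord IsMaxSnd (· < ·) dirSW P Pt ∧ ReadsWord IsMaxFst (· > ·) dirSW P Qt

/-- `𝒱(𝒫, ↖) = (Pt, Qt)`: P-word right-to-left along the top edge, Q-word
bottom-to-top along the left edge. -/
def ViennotNW (P : Set (ℤ × ℤ)) (Pt Qt : List (List ℕ)) : Prop :=
  ReadsWord IsMaxFst (· > ·) dirNW P Pt ∧ ReadsWord IsMinSnd (· < ·) dirNW P Qt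

/-- The point set `𝒫^NE(ρ)` of the northeast `n × n` block of the permutation matrix of
`ρ ∈ S_{2n}`, in Cartesian coordinates. -/
def pointsNE (n : ℕ) (f : ℕ → ℕ) : Set (ℤ × ℤ) :=
  {p | ∃ x : ℕ, 1 ≤ x ∧ x ≤ n ∧ n < f x ∧ p = ((f x : ℤ) - n, (n : ℤ) + 1 - x)}

/-! ## Crossings and nestings of perfect matchings -/

/-- The matching `{a, f a}` on `{1, …, N}` has a `k`-crossing:
blocks `{a₁ < b₁}, …, {a_k < b_k}` with `a₁ < ⋯ < a_k < b₁ < ⋯ < b_k`. -/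
def HasCrossing (f : ℕ → ℕ) (N k : ℕ) : Prop :=
  ∃ a b : Fin k → ℕ, StrictMono a ∧ StrictMono b ∧
    (∀ m, 1 ≤ a m ∧ b m ≤ N ∧ f (a m) = b m ∧ a m < b m) ∧
    ∀ m m' : Fin k, a m < b m'

/-- The matching `{a, f a}` on `{1, …, N}` has a `k`-nesting:
blocks `{a₁ < b₁}, …, {a_k < b_k}` with `a₁ < ⋯ < a_k < b_k < ⋯ < b₁`. -/
def HasNesting (f : ℕ → ℕ) (N k : ℕ) : Prop :=
  ∃ a b : Fin k → ℕ, StrictMono a ∧ StrictAnti b ∧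
    (∀ m, 1 ≤ a m ∧ b m ≤ N ∧ f (a m) = b m ∧ a m < b m) ∧
    ∀ m m' : Fin k, a m < b m'

/-! ## Local rules, the promotion–evacuation diagram, and the promotion matrix -/

/-- Partitions are encoded as lists of row lengths (fixed length, padded by zeros). -/
def sortDesc (l : List ℕ) : List ℕ := List.insertionSort (· ≥ ·) l

/-- The sequence `ν + κ - λ` (pointwise). -/
def ruleSeq (lam nu ka : List ℕ) : List ℕ :=
  List.zipWith (fun a b => a - b) (List.zipWith (· + ·) nu ka) lam

/-- The local rule: `μ = sort(ν + κ - λ)`. -/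
def localRule (lam nu ka : List ℕ) : List ℕ := sortDesc (ruleSeq lam nu ka)

/-- The decoration of a local rule square: `i` if `ν + κ - λ` fails to be sorted at rows
`i, i+1` (1-indexed), and `0` if no decoration is present. -/
def decoration (lam nu ka : List ℕ) : ℕ :=
  match (List.range (ruleSeq lam nu ka).length).find? (fun i =>
      decide ((ruleSeq lam nu ka).getD i 0 < (ruleSeq lam nu ka).getD (i + 1) 0)) with
  | some i => i + 1
  | none => 0

/-- Fill in the next row of the promotion–evacuation diagram from the previous row `prev`:
the new row starts with the empty partition at position `s` and continues by local rules. -/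
def nextRow (R : ℕ) (prev : ℕ → List ℕ) (s : ℕ) : ℕ → List ℕ
  | 0 => List.replicate R 0
  | x + 1 =>
    if x + 1 ≤ s then List.replicate R 0
    else localRule (prev x) (prev (x + 1)) (nextRow R prev s x)

/-- The `j`-th row of the promotion–evacuation diagram of `T ∈ SYT(R × C)`, as a function
of the column index (row `0` is the chain of `T`). -/
def PErow (R C : ℕ) (T : ℕ → ℕ → ℕ) : ℕ → ℕ → List ℕ
  | 0 => fun x => (List.range R).map fun i =>
      ((Finset.range C).filter fun j => T i j ≤ min x (R * C)).card
  | j + 1 => nextRow R (PErow R C T j) (j + 1)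

/-- For `S = stack(P, Q) ∈ SYT(2r × c)` and `n = r*c`, the `(n+1) × (n+1)` northeast block
of partitions `λ(x, y)` of `PEdiagram(S)` (Cartesian coordinates): `λ(x,y)` is the
diagram entry in row `n - y`, column `n + x`. -/
def lamBlock (r c : ℕ) (S : ℕ → ℕ → ℕ) (x y : ℕ) : List ℕ :=
  PErow (2 * r) c S (r * c - y) (r * c + x)

/-- The entry of `PM(S)^NE` at Cartesian coordinates `(x, y)`, `1 ≤ x, y ≤ n`: the
decoration of the local rule square with corners `λ(x-1, y-1)`, `λ(x-1, y)`, `λ(x, y-1)`,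
`λ(x, y)`. -/
def PMNE (r c : ℕ) (S : ℕ → ℕ → ℕ) (x y : ℕ) : ℕ :=
  decoration (lamBlock r c S (x - 1) y) (lamBlock r c S x y) (lamBlock r c S (x - 1) (y - 1))

/-- Chain of partitions of a list tableau: shape of the entries `≤ m`. -/
def chainOfL (T : List (List ℕ)) (m : ℕ) : List ℕ :=
  T.map fun row => (row.filter fun a => decide (a ≤ m)).length

/-- Column height `#{i : j < l i}` of a partition. -/
def colHeight (l : List ℕ) (j : ℕ) : ℕ := (l.filter fun a => decide (j < a)).length

/-- Vertical sum `l +' m` of two partitions (stack the columns of `m` onto those of `l`),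
computed inside a `rows × cols` bounding box. -/
def vsum (rows cols : ℕ) (l m : List ℕ) : List ℕ :=
  (List.range rows).map fun i =>
    ((List.range cols).filter fun j => decide (i < colHeight l j + colHeight m j)).length

/-! ## The point sets `S_k` and `S_{kj}` -/

/-- `x_{sj}`: the entry of `Q` in row `s`, column `j` (1-indexed). -/
def xEnt (Q : ℕ → ℕ → ℕ) (s j : ℕ) : ℤ := (Q (s - 1) (j - 1) : ℤ)

/-- `y_{tj}`: the entry of `∂(P)` in row `t`, column `j` (1-indexed). -/
def yEnt (r c : ℕ) (P : ℕ → ℕ → ℕ) (t j : ℕ) : ℤ :=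
  (entryL (evacL (toListT r c P)) (t - 1) (j - 1) : ℤ)

def Skj (r c : ℕ) (P Q : ℕ → ℕ → ℕ) (k j : ℕ) : Set (ℤ × ℤ) :=
  {p | ∃ s t : ℕ, 1 ≤ s ∧ s ≤ r ∧ 1 ≤ t ∧ t ≤ r ∧ s + t - 1 = k ∧
    p = (xEnt Q s j, yEnt r c P t j)}

def Sk (r c : ℕ) (P Q : ℕ → ℕ → ℕ) (k : ℕ) : Set (ℤ × ℤ) :=
  ⋃ j ∈ Set.Icc 1 c, Skj r c P Q k j

/-- A southeast chain of `k` ones in the matrix `U` (rows increase, columns increase),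
contained in a rectangle that fully fits into the strictly upper triangular part of the
`N × N` matrix. -/
def HasSEChain (U : ℕ → ℕ → ℕ) (N k : ℕ) : Prop :=
  ∃ a b : Fin k → ℕ, StrictMono a ∧ StrictMono b ∧ (∀ m, U (a m) (b m) = 1) ∧
    ∃ r₁ r₂ c₁ c₂ : ℕ, 1 ≤ r₁ ∧ r₂ < c₁ ∧ c₂ ≤ N ∧
      ∀ m, r₁ ≤ a m ∧ a m ≤ r₂ ∧ c₁ ≤ b m ∧ b m ≤ c₂

/-- A southwest chain of `k` ones in the matrix `U` (rows increase, columns decrease),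
contained in a rectangle that fully fits into the strictly upper triangular part of the
`N × N` matrix. -/
def HasSWChain (U : ℕ → ℕ → ℕ) (N k : ℕ) : Prop :=
  ∃ a b : Fin k → ℕ, StrictMono a ∧ StrictAnti b ∧ (∀ m, U (a m) (b m) = 1) ∧
    ∃ r₁ r₂ c₁ c₂ : ℕ, 1 ≤ r₁ ∧ r₂ < c₁ ∧ c₂ ≤ N ∧
      ∀ m, r₁ ≤ a m ∧ a m ≤ r₂ ∧ c₁ ≤ b m ∧ b m ≤ c₂

/-! ## Local rules on partitions given by row-length functions -/

theorem sortDesc_eq_of_perm {l l' : List ℕ} (h : l.Perm l') (h' : l'.Pairwise (· ≥ ·)) :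
    sortDesc l = l' := by
  have hs : (sortDesc l).Pairwise (· ≥ ·) := List.pairwise_insertionSort _ _
  exact List.Perm.eq_of_pairwise' hs h' ((List.perm_insertionSort _ _).trans h)

theorem ruleSeq_map (R : ℕ) (lam nu ka : ℕ → ℕ) :
    ruleSeq ((List.range R).map lam) ((List.range R).map nu) ((List.range R).map ka) =
      (List.range R).map fun i => nu i + ka i - lam i := by
  apply List.ext_getElem <;> simp [ruleSeq]

theorem pairwise_map_range {R : ℕ} {f : ℕ → ℕ} (hf : Antitone f) :
    ((List.range R).map f).Pairwise (· ≥ ·) := by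
  rw [List.pairwise_map]
  exact List.pairwise_lt_range.imp fun h => hf h.le

theorem getD_map_range (R : ℕ) (f : ℕ → ℕ) (i : ℕ) :
    ((List.range R).map f).getD i 0 = if i < R then f i else 0 := by
  by_cases h : i < R <;> simp [List.getD, h]

/-- If `ν + κ - λ` is already a partition, the local rule returns it. -/
theorem localRule_of_antitone {R : ℕ} {lam nu ka mu : ℕ → ℕ} (hmu : Antitone mu)
    (h : ∀ i < R, mu i + lam i = nu i + ka i) :
    localRule ((List.range R).map lam) ((List.range R).map nu) ((List.range R).map ka) =
      (List.range R).map mu := by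
  have e : ((List.range R).map fun i => nu i + ka i - lam i) = (List.range R).map mu := by
    apply List.map_congr_left
    intro i hi
    have := h i (List.mem_range.1 hi)
    omega
  rw [localRule, ruleSeq_map, e]
  exact sortDesc_eq_of_perm (List.Perm.refl _) (pairwise_map_range hmu)

theorem decoration_of_antitone {R : ℕ} {lam nu ka mu : ℕ → ℕ} (hmu : Antitone mu)
    (h : ∀ i < R, mu i + lam i = nu i + ka i) :
    decoration ((List.range R).map lam) ((List.range R).map nu) ((List.range R).map ka) = 0 := by
  have e : ((List.range R).map fun i => nu i + ka i - lam i) = (List.range R).map mu := by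
    apply List.map_congr_left
    intro i hi
    have := h i (List.mem_range.1 hi)
    omega
  rw [decoration, ruleSeq_map, e]
  split
  · rename_i i hi
    have := List.find?_some hi
    simp only [getD_map_range, decide_eq_true_eq] at this
    have hstep : mu (i + 1) ≤ mu i := hmu (Nat.le_succ i)
    split_ifs at * <;> omega
  · rfl

/-- If a cell is added directly below the removed cell, the local rule returns `λ`. -/
theorem localRule_of_below {R b : ℕ} {lam nu ka : ℕ → ℕ} (hlam : Antitone lam)
    (hb : b + 1 < R) (hstep : lam b = lam (b + 1) + 1)
    (hnu : ∀ i, nu i = lam i + if i = b + 1 then 1 else 0)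
    (hka : ∀ i, ka i + (if i = b then 1 else 0) = lam i) :
    localRule ((List.range R).map lam) ((List.range R).map nu) ((List.range R).map ka) =
      (List.range R).map lam := by
  have e : ((List.range R).map fun i => nu i + ka i - lam i) =
      (List.range R).map (lam ∘ Equiv.swap b (b + 1)) := by
    apply List.map_congr_left
    intro i hi
    have h1 := hnu i
    have h2 := hka i
    simp only [Function.comp]
    by_cases hib : i = b
    · subst hib; simp at h1 h2 ⊢; omega
    by_cases hib' : i = b + 1
    · subst hib'; simp at h1 h2 ⊢; omega
    rw [Equiv.swap_apply_of_ne_of_ne hib hib']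
    simp only [hib, hib', if_false] at h1 h2
    omega
  rw [localRule, ruleSeq_map, e]
  refine sortDesc_eq_of_perm ?_ (pairwise_map_range hlam)
  rw [← List.map_map]
  refine List.Perm.map _ ?_
  refine (List.perm_ext_iff_of_nodup (List.nodup_range.map (Equiv.injective _))
    List.nodup_range).2 fun a => ?_
  simp only [List.mem_map, List.mem_range]
  constructor
  · rintro ⟨x, hx, rfl⟩
    rw [Equiv.swap_apply_def]
    split_ifs <;> omega
  · intro ha
    refine ⟨Equiv.swap b (b + 1) a, ?_, Equiv.swap_apply_self _ _ _⟩
    rw [Equiv.swap_apply_def]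
    split_ifs <;> omega

theorem decoration_of_below {R b : ℕ} {lam nu ka : ℕ → ℕ} (hlam : Antitone lam)
    (hb : b + 1 < R) (hstep : lam b = lam (b + 1) + 1)
    (hnu : ∀ i, nu i = lam i + if i = b + 1 then 1 else 0)
    (hka : ∀ i, ka i + (if i = b then 1 else 0) = lam i) :
    decoration ((List.range R).map lam) ((List.range R).map nu) ((List.range R).map ka) =
      b + 1 := by
  have key : ∀ i, i + 1 < R →
      (nu i + ka i - lam i < nu (i + 1) + ka (i + 1) - lam (i + 1) ↔ i = b) := by
    intro i _
    have h1 := hnu i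
    have h2 := hka i
    have h3 := hnu (i + 1)
    have h4 := hka (i + 1)
    have h5 := hlam (Nat.le_succ i)
    constructor
    · intro h
      by_contra hne
      simp only [hne, if_false, Nat.succ_eq_add_one, Nat.add_right_cancel_iff] at *
      split_ifs at * <;> omega
    · rintro rfl
      simp at *
      omega
  rw [decoration, ruleSeq_map]
  split
  · rename_i i hi
    have := List.find?_some hi
    simp only [getD_map_range, decide_eq_true_eq] at this
    split_ifs at this with h1 h2 h2
    · rw [(key i h2).1 this]
    all_goals omega
  · rename_i hi
    have := List.find?_eq_none.1 hi b (by simp; omega)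
    simp only [getD_map_range, decide_eq_true_eq] at this
    rw [if_pos (by omega), if_pos hb, key b hb] at this
    exact absurd rfl this

/-! ## Jeu de taquin slides on standard fillings -/

/-- The length of row `i` of a list-of-rows tableau. -/
def rowLen (T : List (List ℕ)) (i : ℕ) : ℕ := (T.getD i []).length

/-- `p` is a cell of `T`. -/
def IsCell (T : List (List ℕ)) (p : ℕ × ℕ) : Prop := p.2 < rowLen T p.1

/-- The entry of `T` in the cell `p`. -/
def val (T : List (List ℕ)) (p : ℕ × ℕ) : ℕ := entryL T p.1 p.2

/-- `T` is a standard filling of a partition shape with at most `r` rows by the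
entries `k + 1, …, n`. -/
structure IsStandard (r k n : ℕ) (T : List (List ℕ)) : Prop where
  length_le : T.length ≤ r
  anti : Antitone (rowLen T)
  row : ∀ i j, IsCell T (i, j + 1) → val T (i, j) < val T (i, j + 1)
  col : ∀ i j, IsCell T (i + 1, j) → val T (i, j) < val T (i + 1, j)
  inj : ∀ p q, IsCell T p → IsCell T q → val T p = val T q → p = q
  range : ∀ p, IsCell T p → k < val T p ∧ val T p ≤ n
  surj : ∀ v, k < v → v ≤ n → ∃ p, IsCell T p ∧ val T p = v
  card : T.flatten.length + k = n

theorem extL_eq_top {T : List (List ℕ)} {p : ℕ × ℕ} : extL T p = ⊤ ↔ ¬ IsCell T p := by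
  unfold extL IsCell rowLen
  split_ifs with h
  · exact iff_of_false (WithTop.coe_ne_top) (not_not.2 h)
  · exact iff_of_true rfl h

theorem extL_of_isCell {T : List (List ℕ)} {p : ℕ × ℕ} (h : IsCell T p) :
    extL T p = ((val T p : ℕ) : WithTop ℕ) :=
  if_pos h

theorem nextCellL_spec (T : List (List ℕ)) (p : ℕ × ℕ) :
    (nextCellL T p = p ∧ ¬ IsCell T (p.1, p.2 + 1) ∧ ¬ IsCell T (p.1 + 1, p.2)) ∨
    ((nextCellL T p = (p.1, p.2 + 1) ∨ nextCellL T p = (p.1 + 1, p.2)) ∧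
      IsCell T (nextCellL T p) ∧
      (IsCell T (p.1, p.2 + 1) → val T (nextCellL T p) ≤ val T (p.1, p.2 + 1)) ∧
      (IsCell T (p.1 + 1, p.2) → val T (nextCellL T p) ≤ val T (p.1 + 1, p.2))) := by
  unfold nextCellL
  by_cases hE : IsCell T (p.1, p.2 + 1) <;> by_cases hS : IsCell T (p.1 + 1, p.2)
  · right
    rw [if_neg (by simp [extL_eq_top, hE]), extL_of_isCell hE, extL_of_isCell hS]
    split_ifs with h
    · exact ⟨Or.inl rfl, hE, fun _ => le_rfl, fun _ => by exact_mod_cast h.le⟩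
    · exact ⟨Or.inr rfl, hS, fun _ => by exact_mod_cast not_lt.1 h, fun _ => le_rfl⟩
  · right
    rw [if_neg (by simp [extL_eq_top, hE]), extL_of_isCell hE, extL_eq_top.2 hS]
    rw [if_pos (by exact WithTop.coe_lt_top _)]
    exact ⟨Or.inl rfl, hE, fun _ => le_rfl, fun h => absurd h hS⟩
  · right
    rw [if_neg (by simp [extL_eq_top, hS]), extL_of_isCell hS, extL_eq_top.2 hE]
    rw [if_neg (by simp)]
    exact ⟨Or.inr rfl, hS, fun h => absurd h hE, fun _ => le_rfl⟩
  · left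
    rw [if_pos ⟨extL_eq_top.2 hE, extL_eq_top.2 hS⟩]
    exact ⟨rfl, hE, hS⟩

theorem sum_map_range (n : ℕ) (f : ℕ → ℕ) :
    ((List.range n).map f).sum = ∑ i ∈ Finset.range n, f i := by
  simp [Finset.sum, Finset.range, Multiset.range]

section Slide

variable {r k n : ℕ} {T : List (List ℕ)}

theorem IsStandard.isCell_of_le (hT : IsStandard r k n T) {p q : ℕ × ℕ} (hp : IsCell T p)
    (h1 : q.1 ≤ p.1) (h2 : q.2 ≤ p.2) : IsCell T q :=
  lt_of_le_of_lt h2 (lt_of_lt_of_le hp (hT.anti h1))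

theorem IsStandard.val_origin (hT : IsStandard r k n T) (hkn : k < n) :
    IsCell T (0, 0) ∧ val T (0, 0) = k + 1 := by
  obtain ⟨⟨i, j⟩, hp, hv⟩ := hT.surj (k + 1) (by omega) (by omega)
  rcases j with _ | j
  · rcases i with _ | i
    · exact ⟨hp, hv⟩
    · have := hT.col i 0 hp
      have := (hT.range (i, 0) (hT.isCell_of_le hp (by simp) (by simp))).1
      omega
  · have := hT.row i j hp
    have := (hT.range (i, j) (hT.isCell_of_le hp (by simp) (by simp))).1
    omega

theorem IsStandard.val_lt_next (hT : IsStandard r k n T) {p : ℕ × ℕ}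
    (h : nextCellL T p ≠ p) : val T p < val T (nextCellL T p) := by
  rcases nextCellL_spec T p with h' | ⟨h1 | h1, hc, -⟩
  · exact absurd h'.1 h
  · rw [h1] at hc ⊢
    exact hT.row _ _ hc
  · rw [h1] at hc ⊢
    exact hT.col _ _ hc

theorem sum_nextCellL {p : ℕ × ℕ} (h : nextCellL T p ≠ p) :
    (nextCellL T p).1 + (nextCellL T p).2 = p.1 + p.2 + 1 := by
  rcases nextCellL_spec T p with h' | ⟨h1 | h1, -⟩
  · exact absurd h'.1 h
  · rw [h1]; ring
  · rw [h1]; ring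

/-- `L` is the length of the sliding path of `T`. -/
structure IsPathLength (T : List (List ℕ)) (L : ℕ) : Prop where
  lt : L < T.flatten.length
  move : ∀ i < L, nextCellL T (jdtPath T i) ≠ jdtPath T i
  fixed : nextCellL T (jdtPath T L) = jdtPath T L

theorem IsStandard.isCell_jdtPath (hT : IsStandard r k n T) (hkn : k < n) (i : ℕ) :
    IsCell T (jdtPath T i) := by
  induction i with
  | zero => exact (hT.val_origin hkn).1
  | succ i ih =>
    rw [jdtPath]
    rcases nextCellL_spec T (jdtPath T i) with h | h
    · rw [h.1]; exact ih
    · exact h.2.1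

theorem IsStandard.exists_pathLength (hT : IsStandard r k n T) (hkn : k < n) :
    ∃ L, IsPathLength T L := by
  classical
  have hex : ∃ L, L < T.flatten.length ∧ nextCellL T (jdtPath T L) = jdtPath T L := by
    by_contra! hno
    have hv : ∀ i ≤ T.flatten.length, k + 1 + i ≤ val T (jdtPath T i) := by
      intro i
      induction i with
      | zero => intro _; exact (hT.val_origin hkn).2.ge
      | succ i ih =>
        intro hi
        have h1 := ih (by omega)
        have h2 := hT.val_lt_next (hno i (by omega))
        rw [jdtPath]
        omega
    have h1 := hv _ le_rfl
    have h2 := (hT.range _ (hT.isCell_jdtPath hkn T.flatten.length)).2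
    have h3 := hT.card
    omega
  refine ⟨Nat.find hex, (Nat.find_spec hex).1, fun i hi h => ?_, (Nat.find_spec hex).2⟩
  exact Nat.find_min hex hi ⟨hi.trans (Nat.find_spec hex).1, h⟩

namespace IsPathLength

variable {L : ℕ}

theorem sum_jdtPath (hL : IsPathLength T L) {i : ℕ} (hi : i ≤ L) :
    (jdtPath T i).1 + (jdtPath T i).2 = i := by
  induction i with
  | zero => rfl
  | succ i ih =>
    rw [jdtPath, sum_nextCellL (hL.move i hi), ih (by omega)]

theorem jdtPath_inj (hL : IsPathLength T L) {i j : ℕ} (hi : i ≤ L) (hj : j ≤ L)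
    (h : jdtPath T i = jdtPath T j) : i = j := by
  rw [← hL.sum_jdtPath hi, ← hL.sum_jdtPath hj, h]

theorem jdtPath_of_le (hL : IsPathLength T L) {i : ℕ} (hi : L ≤ i) :
    jdtPath T i = jdtPath T L := by
  induction i, hi using Nat.le_induction with
  | base => rfl
  | succ i _ ih => rw [jdtPath, ih, hL.fixed]

theorem vacated_eq (hL : IsPathLength T L) : vacated T = jdtPath T L :=
  hL.jdtPath_of_le hL.lt.le

theorem val_jdtPath_lt (hL : IsPathLength T L) (hT : IsStandard r k n T) {i j : ℕ}
    (hij : i < j) (hj : j ≤ L) : val T (jdtPath T i) < val T (jdtPath T j) := by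
  induction j, hij using Nat.le_induction with
  | base => exact hT.val_lt_next (hL.move i hj)
  | succ j _ ih => exact (ih (by omega)).trans (hT.val_lt_next (hL.move j hj))

theorem val_jdtPath_le (hL : IsPathLength T L) (hT : IsStandard r k n T) {i j : ℕ}
    (hij : i ≤ j) (hj : j ≤ L) : val T (jdtPath T i) ≤ val T (jdtPath T j) := by
  rcases hij.eq_or_lt with rfl | h
  · rfl
  · exact (hL.val_jdtPath_lt hT h hj).le

theorem slidValue_path (hL : IsPathLength T L) {i : ℕ} (hi : i < L) :
    slidValue T (jdtPath T i).1 (jdtPath T i).2 = val T (jdtPath T (i + 1)) := by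
  unfold slidValue
  split
  · rename_i m hm
    have h := List.find?_some hm
    simp only [Prod.mk.eta, decide_eq_true_eq] at h
    have hmL : m < L := by
      by_contra hge
      apply h.2
      rw [← h.1, hL.jdtPath_of_le (by omega : L ≤ m + 1), hL.jdtPath_of_le (by omega : L ≤ m)]
    rw [hL.jdtPath_inj hmL.le hi.le h.1]
    rfl
  · rename_i hm
    have h := List.find?_eq_none.1 hm i (List.mem_range.2 (hi.trans hL.lt))
    simp only [Prod.mk.eta, decide_eq_true_eq, true_and, not_not] at h
    exact absurd h (hL.move i hi)

theorem slidValue_of_notMem (hL : IsPathLength T L) {p : ℕ × ℕ}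
    (hp : ∀ i < L, jdtPath T i ≠ p) : slidValue T p.1 p.2 = val T p := by
  unfold slidValue
  split
  · rename_i m hm
    have h := List.find?_some hm
    simp only [Prod.mk.eta, decide_eq_true_eq] at h
    have hmL : m < L := by
      by_contra hge
      apply h.2
      rw [← h.1, hL.jdtPath_of_le (by omega : L ≤ m + 1), hL.jdtPath_of_le (by omega : L ≤ m)]
    exact absurd h.1 (hp m hmL)
  · rfl

theorem not_isCell_next (hL : IsPathLength T L) :
    ¬ IsCell T ((vacated T).1, (vacated T).2 + 1) ∧
      ¬ IsCell T ((vacated T).1 + 1, (vacated T).2) := by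
  rw [hL.vacated_eq]
  rcases nextCellL_spec T (jdtPath T L) with h | ⟨h, -⟩
  · exact h.2
  · rw [hL.fixed] at h
    rcases h with h | h <;> simp [Prod.ext_iff] at h

end IsPathLength

theorem getD_filter_ne_nil {M : List (List ℕ)} (hM : Antitone (rowLen M)) (i : ℕ) :
    (M.filter fun row => decide (row ≠ [])).getD i [] = M.getD i [] := by
  induction M generalizing i with
  | nil => rfl
  | cons a M ih =>
    have hM' : Antitone (rowLen M) := fun x y hxy => by
      have := hM (Nat.succ_le_succ hxy)
      simpa [rowLen] using this
    by_cases ha : a = []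
    · have hz : ∀ j, (a :: M).getD j [] = [] := fun j => by
        have := hM (Nat.zero_le j)
        simp only [rowLen] at this
        apply List.eq_nil_of_length_eq_zero
        simpa [ha] using this
      have : ((a :: M).filter fun row => decide (row ≠ [])) = [] := by
        rw [List.filter_eq_nil_iff]
        intro b hb
        obtain ⟨j, hj, rfl⟩ := List.getElem_of_mem hb
        have := hz j
        rw [List.getD_eq_getElem _ _ hj] at this
        simp [this]
      rw [this, hz]
      rfl
    · rw [List.filter_cons_of_pos (by simpa using ha)]
      cases i with
      | zero => rfl
      | succ i => simpa using ih hM' i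

theorem IsStandard.vacated_snd (hT : IsStandard r k n T) (hkn : k < n) :
    rowLen T (vacated T).1 = (vacated T).2 + 1 ∧
      rowLen T ((vacated T).1 + 1) ≤ (vacated T).2 := by
  obtain ⟨L, hL⟩ := hT.exists_pathLength hkn
  have h1 := hL.not_isCell_next
  have h2 := hT.isCell_jdtPath hkn L
  rw [← hL.vacated_eq] at h2
  simp only [IsCell] at h1 h2
  omega

theorem IsStandard.antitone_sub (hT : IsStandard r k n T) (hkn : k < n) :
    Antitone fun i => rowLen T i - if i = (vacated T).1 then 1 else 0 := by
  apply antitone_nat_of_succ_le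
  intro i
  have h1 := hT.anti (Nat.le_succ i)
  have h2 := hT.vacated_snd hkn
  simp only [Nat.succ_eq_add_one] at h1
  by_cases h : i = (vacated T).1
  · subst h
    simp
    omega
  · simp only [h, if_false]
    omega

theorem IsStandard.getD_delta (hT : IsStandard r k n T) (hkn : k < n) (i : ℕ) :
    (delta T).getD i [] =
      (List.range (rowLen T i - if i = (vacated T).1 then 1 else 0)).map fun j =>
        slidValue T i j := by
  have key : ∀ i, ((List.range T.length).map fun i =>
      (List.range ((T.getD i []).length - if i = (vacated T).1 then 1 else 0)).map fun j =>
        slidValue T i j).getD i [] =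
      (List.range (rowLen T i - if i = (vacated T).1 then 1 else 0)).map fun j =>
        slidValue T i j := by
    intro i
    by_cases h : i < T.length
    · rw [List.getD_eq_getElem _ _ (by simpa using h)]
      simp [rowLen]
    · rw [List.getD_eq_default _ _ (by simpa using h)]
      rw [rowLen, List.getD_eq_default _ _ (not_lt.1 h)]
      simp
  rw [delta, getD_filter_ne_nil _ i, key]
  have : rowLen ((List.range T.length).map fun i =>
      (List.range ((T.getD i []).length - if i = (vacated T).1 then 1 else 0)).map fun j =>
        slidValue T i j) = fun i => rowLen T i - if i = (vacated T).1 then 1 else 0 := by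
    funext i
    rw [rowLen, key]
    simp
  rw [this]
  exact hT.antitone_sub hkn

theorem IsStandard.rowLen_delta (hT : IsStandard r k n T) (hkn : k < n) (i : ℕ) :
    rowLen (delta T) i = rowLen T i - if i = (vacated T).1 then 1 else 0 := by
  rw [rowLen, hT.getD_delta hkn]
  simp

theorem IsStandard.isCell_delta (hT : IsStandard r k n T) (hkn : k < n) (p : ℕ × ℕ) :
    IsCell (delta T) p ↔ IsCell T p ∧ p ≠ vacated T := by
  have h := hT.vacated_snd hkn
  rw [IsCell, IsCell, hT.rowLen_delta hkn, Ne, Prod.ext_iff]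
  by_cases h1 : p.1 = (vacated T).1
  · simp only [h1, if_true, true_and]
    omega
  · simp [h1]

theorem IsStandard.val_delta (hT : IsStandard r k n T) (hkn : k < n) {p : ℕ × ℕ}
    (hp : IsCell (delta T) p) : val (delta T) p = slidValue T p.1 p.2 := by
  have hp' := hp
  rw [IsCell, hT.rowLen_delta hkn] at hp'
  rw [val, entryL, hT.getD_delta hkn, getD_map_range, if_pos hp']

theorem IsStandard.length_flatten_delta (hT : IsStandard r k n T) (hkn : k < n) :
    (delta T).flatten.length + 1 = T.flatten.length := by
  have h := hT.vacated_snd hkn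
  have hlt : (vacated T).1 < T.length := by
    by_contra hge
    rw [rowLen, List.getD_eq_default _ _ (not_lt.1 hge)] at h
    simp at h
  have e : T.flatten.length = ∑ i ∈ Finset.range T.length, rowLen T i := by
    rw [List.length_flatten, ← sum_map_range]
    congr 1
    apply List.ext_getElem
    · simp
    · intro i h1 _
      rw [List.length_map] at h1
      simp only [List.getElem_map, List.getElem_range, rowLen]
      rw [List.getD_eq_getElem _ _ h1]
  have e' : (delta T).flatten.length = ∑ i ∈ Finset.range T.length,
      (rowLen T i - if i = (vacated T).1 then 1 else 0) := by
    rw [delta, List.flatten_filter_ne_nil, List.length_flatten, List.map_map,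
      ← sum_map_range]
    congr 1
    apply List.map_congr_left
    intro i _
    simp [rowLen]
  have hs : ∑ i ∈ Finset.range T.length, (if i = (vacated T).1 then 1 else 0) = 1 := by
    simp [hlt]
  have hadd : ∑ i ∈ Finset.range T.length, rowLen T i = ∑ i ∈ Finset.range T.length,
      (rowLen T i - if i = (vacated T).1 then 1 else 0) +
      ∑ i ∈ Finset.range T.length, (if i = (vacated T).1 then 1 else 0) := by
    rw [← Finset.sum_add_distrib]
    apply Finset.sum_congr rfl
    intro i _
    by_cases hi : i = (vacated T).1
    · subst hi
      simp
      omega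
    · simp [hi]
  omega

end Slide

/-! ## The sublevel sets of a slide -/

section Hole

variable {r k n L : ℕ} {T : List (List ℕ)}

/-- The `K`-th cell of the sliding path is the last one whose entry is at most `m`. -/
structure IsHole (T : List (List ℕ)) (L K m : ℕ) : Prop where
  le : K ≤ L
  val_le : val T (jdtPath T K) ≤ m
  lt_val : K < L → m < val T (jdtPath T (K + 1))

theorem IsHole.succ {K m : ℕ} (h : IsHole T L K m) :
    IsHole T L K (m + 1) ∨ (K < L ∧ val T (jdtPath T (K + 1)) = m + 1) := by
  by_cases hc : K < L ∧ val T (jdtPath T (K + 1)) = m + 1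
  · exact Or.inr hc
  · refine Or.inl ⟨h.le, h.val_le.trans (Nat.le_succ m), fun hK => ?_⟩
    have := h.lt_val hK
    omega

theorem IsPathLength.isHole_succ (hL : IsPathLength T L) (hT : IsStandard r k n T) {K m : ℕ}
    (hK : K < L) (hv : val T (jdtPath T (K + 1)) = m) : IsHole T L (K + 1) m :=
  ⟨hK, hv.le, fun h => hv ▸ hL.val_jdtPath_lt hT (Nat.lt_succ_self _) h⟩

theorem IsPathLength.exists_isHole (hL : IsPathLength T L) (hT : IsStandard r k n T)
    (hkn : k < n) {m : ℕ} (hm : k + 1 ≤ m) : ∃ K, IsHole T L K m := by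
  induction m, hm using Nat.le_induction with
  | base =>
    have h0 := (hT.val_origin hkn).2
    exact ⟨0, Nat.zero_le _, h0.le, fun h => h0 ▸ hL.val_jdtPath_lt hT Nat.zero_lt_one h⟩
  | succ m _ ih =>
    obtain ⟨K, hK⟩ := ih
    rcases hK.succ with h | ⟨h1, h2⟩
    · exact ⟨K, h⟩
    · exact ⟨K + 1, hL.isHole_succ hT h1 h2⟩

theorem IsHole.lt_val_right (hL : IsPathLength T L) {K m : ℕ} (h : IsHole T L K m)
    (hc : IsCell T ((jdtPath T K).1, (jdtPath T K).2 + 1)) :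
    m < val T ((jdtPath T K).1, (jdtPath T K).2 + 1) := by
  rcases nextCellL_spec T (jdtPath T K) with h' | h'
  · exact absurd hc h'.2.1
  · have hKL : K < L := by
      refine h.le.lt_of_ne fun e => ?_
      have := hL.not_isCell_next.1
      rw [hL.vacated_eq, ← e] at this
      exact this hc
    exact (h.lt_val hKL).trans_le (h'.2.2.1 hc)

theorem IsHole.lt_val_below (hL : IsPathLength T L) {K m : ℕ} (h : IsHole T L K m)
    (hc : IsCell T ((jdtPath T K).1 + 1, (jdtPath T K).2)) :
    m < val T ((jdtPath T K).1 + 1, (jdtPath T K).2) := by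
  rcases nextCellL_spec T (jdtPath T K) with h' | h'
  · exact absurd hc h'.2.2
  · have hKL : K < L := by
      refine h.le.lt_of_ne fun e => ?_
      have := hL.not_isCell_next.2
      rw [hL.vacated_eq, ← e] at this
      exact this hc
    exact (h.lt_val hKL).trans_le (h'.2.2.2 hc)

/-- Sliding removes exactly the hole from each sublevel set. -/
theorem IsHole.sublevel_delta (hL : IsPathLength T L) (hT : IsStandard r k n T) (hkn : k < n)
    {K m : ℕ} (h : IsHole T L K m) (p : ℕ × ℕ) :
    (IsCell (delta T) p ∧ val (delta T) p ≤ m) ↔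
      (IsCell T p ∧ val T p ≤ m ∧ p ≠ jdtPath T K) := by
  have hKL := h.le
  have hcell := hT.isCell_delta hkn p
  rw [hL.vacated_eq] at hcell
  by_cases hp : ∃ i < L, jdtPath T i = p
  · obtain ⟨i, hi, rfl⟩ := hp
    have hc : IsCell T (jdtPath T i) := hT.isCell_jdtPath hkn i
    have hc' : IsCell (delta T) (jdtPath T i) :=
      hcell.2 ⟨hc, fun e => hi.ne (hL.jdtPath_inj hi.le le_rfl e)⟩
    rw [hT.val_delta hkn hc', hL.slidValue_path hi]
    simp only [hc, hc', true_and]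
    constructor
    · intro hm
      have hiK : i < K := by
        by_contra hge
        have h1 := h.lt_val (by omega)
        have h2 := hL.val_jdtPath_le hT (by omega : K + 1 ≤ i + 1) hi
        omega
      refine ⟨?_, fun e => hiK.ne (hL.jdtPath_inj hi.le hKL e)⟩
      exact (hL.val_jdtPath_lt hT (Nat.lt_add_one i) hi).le.trans hm
    · rintro ⟨hm, hne⟩
      have hne' : i ≠ K := fun e => hne (by rw [e])
      by_cases hiK : i < K
      · exact (hL.val_jdtPath_le hT hiK hKL).trans h.val_le
      · have h1 := h.lt_val (by omega)
        have h2 := hL.val_jdtPath_le hT (by omega : K + 1 ≤ i) hi.le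
        omega
  · push Not at hp
    by_cases hc' : IsCell (delta T) p
    · rw [hT.val_delta hkn hc', hL.slidValue_of_notMem hp]
      have hc := hcell.1 hc'
      have hne : p ≠ jdtPath T K := by
        rcases hKL.eq_or_lt with e | e
        · rw [e]; exact hc.2
        · exact (hp K e).symm
      simp [hc', hc.1, hne]
    · refine iff_of_false (fun h => hc' h.1) ?_
      rintro ⟨h1, h2, h3⟩
      have hpL : p = jdtPath T L := by
        by_contra hne
        exact hc' (hcell.2 ⟨h1, hne⟩)
      subst hpL
      have hlt : K < L := hKL.lt_of_ne fun e => h3 (by rw [e])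
      have h4 := h.lt_val hlt
      have h5 := hL.val_jdtPath_le hT (by omega : K + 1 ≤ L) le_rfl
      omega

/-- The entries of the slid filling come from the cells other than the origin. -/
theorem IsPathLength.exists_source (hL : IsPathLength T L) (hT : IsStandard r k n T)
    (hkn : k < n) {p : ℕ × ℕ} (hp : IsCell (delta T) p) :
    ∃ q, IsCell T q ∧ val (delta T) p = val T q ∧
      ((∃ i < L, p = jdtPath T i ∧ q = jdtPath T (i + 1)) ∨
        (q = p ∧ ∀ i ≤ L, jdtPath T i ≠ p)) := by
  rw [hT.val_delta hkn hp]
  by_cases h : ∃ i < L, jdtPath T i = p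
  · obtain ⟨i, hi, rfl⟩ := h
    exact ⟨_, hT.isCell_jdtPath hkn (i + 1), hL.slidValue_path hi, Or.inl ⟨i, hi, rfl, rfl⟩⟩
  · push Not at h
    have hc := (hT.isCell_delta hkn p).1 hp
    refine ⟨p, hc.1, hL.slidValue_of_notMem h, Or.inr ⟨rfl, fun i hi => ?_⟩⟩
    rcases hi.eq_or_lt with e | e
    · rw [e, ← hL.vacated_eq]; exact hc.2.symm
    · exact h i e

theorem IsStandard.slide (hT : IsStandard r k n T) (hkn : k < n) :
    IsStandard r (k + 1) n (delta T) := by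
  obtain ⟨L, hL⟩ := hT.exists_pathLength hkn
  have h0 := hT.val_origin hkn
  have anti : Antitone (rowLen (delta T)) := by
    have : rowLen (delta T) =
        fun i => rowLen T i - if i = (vacated T).1 then 1 else 0 :=
      funext (hT.rowLen_delta hkn)
    rw [this]
    exact hT.antitone_sub hkn
  have hinj : ∀ p q, IsCell (delta T) p → IsCell (delta T) q →
      val (delta T) p = val (delta T) q → p = q := by
    intro p q hp hq hpq
    obtain ⟨p', hp', hvp, hcp⟩ := hL.exists_source hT hkn hp
    obtain ⟨q', hq', hvq, hcq⟩ := hL.exists_source hT hkn hq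
    have e : p' = q' := hT.inj _ _ hp' hq' (by rw [← hvp, ← hvq, hpq])
    rcases hcp with ⟨i, hi, rfl, rfl⟩ | ⟨rfl, hcp⟩ <;>
      rcases hcq with ⟨j, hj, rfl, rfl⟩ | ⟨rfl, hcq⟩
    · have := hL.jdtPath_inj hi hj e
      rw [Nat.succ.inj this]
    · exact absurd e (hcq _ hi)
    · exact absurd e.symm (hcp _ hj)
    · exact e
  have hrange : ∀ p, IsCell (delta T) p →
      k + 1 < val (delta T) p ∧ val (delta T) p ≤ n := by
    intro p hp
    obtain ⟨p', hp', hvp, hcp⟩ := hL.exists_source hT hkn hp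
    rw [hvp]
    have h1 := hT.range p' hp'
    refine ⟨?_, h1.2⟩
    have hne : p' ≠ (0, 0) := by
      rintro rfl
      rcases hcp with ⟨i, hi, -, e⟩ | ⟨rfl, h⟩
      · have := hL.sum_jdtPath hi
        rw [← e] at this
        simp at this
      · exact h 0 (Nat.zero_le _) rfl
    have : val T p' ≠ k + 1 := fun e => hne (hT.inj _ _ hp' h0.1 (e.trans h0.2.symm))
    omega
  have mono : ∀ p q, IsCell (delta T) p → IsCell (delta T) q → p ≠ q →
      (IsCell T q → val T p < val T q) →
      (∀ K m, IsHole T L K m → p = jdtPath T K → IsCell T q → m < val T q) →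
      val (delta T) p < val (delta T) q := by
    intro p q hp hq hpq hlt hhole
    have hm := (hrange q hq).1
    obtain ⟨K, hK⟩ := hL.exists_isHole hT hkn hm.le
    have h1 := (hK.sublevel_delta hL hT hkn q).1 ⟨hq, le_rfl⟩
    have h2 := (hK.sublevel_delta hL hT hkn p).2
      ⟨((hT.isCell_delta hkn p).1 hp).1, (hlt h1.1).le.trans h1.2.1, fun e => by
        have := hhole _ _ hK e h1.1
        have := h1.2.1
        omega⟩
    exact h2.2.lt_of_ne fun e => hpq (hinj _ _ hp hq e)
  constructor
  · unfold delta
    refine (List.length_filter_le _ _).trans ?_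
    simpa using hT.length_le
  · exact anti
  · intro i j hc
    refine mono _ _ (lt_trans (Nat.lt_succ_self _) hc) hc (by simp) (hT.row i j) ?_
    intro K m hK e hc
    have := hK.lt_val_right hL
    rw [← e] at this
    exact this hc
  · intro i j hc
    refine mono _ _ (lt_of_lt_of_le hc (anti (Nat.le_succ _))) hc (by simp) (hT.col i j) ?_
    intro K m hK e hc
    have := hK.lt_val_below hL
    rw [← e] at this
    exact this hc
  · exact hinj
  · exact hrange
  · intro v hv hvn
    obtain ⟨q, hq, rfl⟩ := hT.surj v (by omega) hvn
    by_cases h : ∃ i ≤ L, jdtPath T i = q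
    · obtain ⟨i, hi, rfl⟩ := h
      rcases i with _ | i
      · have : val T (jdtPath T 0) = k + 1 := h0.2
        omega
      · have hc : IsCell (delta T) (jdtPath T i) :=
          (hT.isCell_delta hkn _).2 ⟨hT.isCell_jdtPath hkn i, fun e => by
            rw [hL.vacated_eq] at e
            have := hL.jdtPath_inj (Nat.le_of_succ_le hi) le_rfl e
            omega⟩
        exact ⟨_, hc, by rw [hT.val_delta hkn hc, hL.slidValue_path hi]⟩
    · push Not at h
      have hc : IsCell (delta T) q := (hT.isCell_delta hkn _).2
        ⟨hq, fun e => h L le_rfl (by rw [e, hL.vacated_eq])⟩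
      exact ⟨_, hc, by rw [hT.val_delta hkn hc, hL.slidValue_of_notMem fun i hi => h i hi.le]⟩
  · have := hT.length_flatten_delta hkn
    have := hT.card
    omega

end Hole

/-! ## The chain of partitions of a filling -/

/-- The number of entries of row `i` that are at most `m`. -/
def rowCount (T : List (List ℕ)) (m i : ℕ) : ℕ :=
  ((Finset.range (rowLen T i)).filter fun j => val T (i, j) ≤ m).card

/-- The cardinality of an initial segment described by a threshold. -/
theorem card_filter_range_eq {N t : ℕ} {p : ℕ → Prop} [DecidablePred p] (ht : t ≤ N)
    (h : ∀ j < N, p j ↔ j < t) : ((Finset.range N).filter p).card = t := by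
  have : (Finset.range N).filter p = Finset.range t := by
    ext j
    simp only [Finset.mem_filter, Finset.mem_range]
    constructor
    · exact fun hj => (h j hj.1).1 hj.2
    · exact fun hj => ⟨by omega, (h j (by omega)).2 hj⟩
  rw [this, Finset.card_range]

theorem lt_card_filter_range {N : ℕ} {p : ℕ → Prop} [DecidablePred p]
    (h : ∀ i j, i < j → j < N → p j → p i) (j : ℕ) :
    j < ((Finset.range N).filter p).card ↔ j < N ∧ p j := by
  constructor
  · intro hj
    by_contra hno
    have hsub : (Finset.range N).filter p ⊆ Finset.range j := by
      intro i hi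
      simp only [Finset.mem_filter, Finset.mem_range] at hi ⊢
      by_contra hge
      rcases (not_lt.1 hge).eq_or_lt with rfl | hlt
      · exact hno hi
      · exact hno ⟨by omega, h j i hlt hi.1 hi.2⟩
    have := Finset.card_le_card hsub
    rw [Finset.card_range] at this
    omega
  · rintro ⟨hj, hp⟩
    have hsub : Finset.range (j + 1) ⊆ (Finset.range N).filter p := by
      intro i hi
      simp only [Finset.mem_filter, Finset.mem_range] at hi ⊢
      refine ⟨by omega, ?_⟩
      rcases (Nat.lt_succ_iff.1 hi).eq_or_lt with rfl | hlt
      · exact hp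
      · exact h i j hlt hj hp
    have := Finset.card_le_card hsub
    rwa [Finset.card_range] at this

section Chain

variable {r k n : ℕ} {T : List (List ℕ)}

theorem IsStandard.row_lt (hT : IsStandard r k n T) {i a b : ℕ} (hab : a < b)
    (hb : IsCell T (i, b)) : val T (i, a) < val T (i, b) := by
  induction b, hab using Nat.le_induction with
  | base => exact hT.row _ _ hb
  | succ b _ ih => exact (ih (lt_trans (Nat.lt_succ_self b) hb)).trans (hT.row _ _ hb)

theorem IsStandard.lt_rowCount (hT : IsStandard r k n T) (m i j : ℕ) :
    j < rowCount T m i ↔ IsCell T (i, j) ∧ val T (i, j) ≤ m := by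
  unfold rowCount
  rw [lt_card_filter_range]
  · rfl
  · intro a b hab hb hv
    exact (hT.row_lt hab hb).le.trans hv

theorem IsStandard.antitone_rowCount (hT : IsStandard r k n T) (m : ℕ) :
    Antitone (rowCount T m) := by
  apply antitone_nat_of_succ_le
  intro i
  by_contra hlt
  have h1 := (hT.lt_rowCount m (i + 1) (rowCount T m i)).1 (not_le.1 hlt)
  have h2 := (hT.lt_rowCount m i (rowCount T m i)).2
    ⟨hT.isCell_of_le h1.1 (by simp) (by simp), (hT.col _ _ h1.1).le.trans h1.2⟩
  omega

theorem IsStandard.rowCount_eq_zero (hT : IsStandard r k n T) {m : ℕ} (hm : m ≤ k) (i : ℕ) :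
    rowCount T m i = 0 := by
  by_contra h
  have h1 := (hT.lt_rowCount m i 0).1 (Nat.pos_of_ne_zero h)
  have h2 := (hT.range _ h1.1).1
  omega

theorem IsStandard.rowCount_top (hT : IsStandard r k n T) (i : ℕ) :
    rowCount T n i = rowLen T i :=
  card_filter_range_eq le_rfl fun j hj => ⟨fun _ => hj, fun _ => (hT.range (i, j) hj).2⟩

/-- Adding a single cell to the sublevel sets changes the row counts by one. -/
theorem rowCount_add {T' : List (List ℕ)} {k' m m' : ℕ} (hT : IsStandard r k n T)
    (hT' : IsStandard r k' n T') {u : ℕ × ℕ} (hu : IsCell T u ∧ val T u ≤ m)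
    (h : ∀ p, (IsCell T' p ∧ val T' p ≤ m') ↔ (IsCell T p ∧ val T p ≤ m) ∧ p ≠ u) (i : ℕ) :
    rowCount T' m' i + (if i = u.1 then 1 else 0) = rowCount T m i := by
  have key : ∀ j, j < rowCount T' m' i ↔ j < rowCount T m i ∧ (i, j) ≠ u := by
    intro j
    rw [hT.lt_rowCount, hT'.lt_rowCount]
    exact h (i, j)
  have hu' := (hT.lt_rowCount m u.1 u.2).2 hu
  by_cases hi : i = u.1
  · subst hi
    simp only [if_true]
    have h1 : ∀ j, j < rowCount T' m' u.1 ↔ j < rowCount T m u.1 ∧ j ≠ u.2 := by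
      intro j
      rw [key j, Ne, Prod.ext_iff]
      simp
    have h2 := h1 u.2
    have h3 := h1 (rowCount T' m' u.1)
    have h4 := h1 (rowCount T m u.1 - 1)
    have h5 := h1 (rowCount T m u.1)
    have h6 := h1 (u.2 + 1)
    have h7 := h1 (rowCount T' m' u.1 - 1)
    have h8 := h1 (rowCount T' m' u.1 + 1)
    omega
  · have h1 : ∀ j, j < rowCount T' m' i ↔ j < rowCount T m i := by
      intro j
      rw [key j]
      refine and_iff_left fun e => hi ?_
      rw [← e]
    have h3 := h1 (rowCount T' m' i)
    have h4 := h1 (rowCount T m i)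
    simp only [hi, if_false]
    omega

/-- Sliding is governed by the local rules. -/
theorem IsStandard.localRule_rowCount (hT : IsStandard r k n T) (hkn : k < n) {m : ℕ}
    (hm : k + 1 ≤ m) {R : ℕ} (hR : r ≤ R) :
    localRule ((List.range R).map (rowCount T m)) ((List.range R).map (rowCount T (m + 1)))
      ((List.range R).map (rowCount (delta T) m)) =
      (List.range R).map (rowCount (delta T) (m + 1)) := by
  obtain ⟨L, hL⟩ := hT.exists_pathLength hkn
  have hT' := hT.slide hkn
  obtain ⟨K, hK⟩ := hL.exists_isHole hT hkn hm
  have remove : ∀ K m, IsHole T L K m → ∀ i,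
      rowCount (delta T) m i + (if i = (jdtPath T K).1 then 1 else 0) =
        rowCount T m i := fun K m hK =>
    rowCount_add hT hT' ⟨hT.isCell_jdtPath hkn K, hK.val_le⟩ fun p => by
      rw [hK.sublevel_delta hL hT hkn p, and_assoc]
  have h1 := remove K m hK
  rcases hK.succ with hK' | ⟨hKL, hv⟩
  · have h2 := remove K (m + 1) hK'
    refine localRule_of_antitone (hT'.antitone_rowCount _) fun i _ => ?_
    have := h1 i
    have := h2 i
    omega
  · have hK' := hL.isHole_succ hT hKL hv
    have h2 := remove (K + 1) (m + 1) hK'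
    have hu := hT.isCell_jdtPath hkn (K + 1)
    have h3 : ∀ i, rowCount T m i + (if i = (jdtPath T (K + 1)).1 then 1 else 0) =
        rowCount T (m + 1) i := by
      refine rowCount_add hT hT ⟨hu, hv.le⟩ fun p => ?_
      constructor
      · rintro ⟨hp, hpm⟩
        refine ⟨⟨hp, by omega⟩, ?_⟩
        rintro rfl
        omega
      · rintro ⟨⟨hp, hpm⟩, hne⟩
        refine ⟨hp, ?_⟩
        have : val T p ≠ m + 1 := fun e => hne (hT.inj _ _ hp hu (e.trans hv.symm))
        omega
    have hmove := hL.move K hKL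
    rcases nextCellL_spec T (jdtPath T K) with h' | ⟨hE | hS, -⟩
    · exact absurd h'.1 hmove
    · refine localRule_of_antitone (hT'.antitone_rowCount _) fun i _ => ?_
      have a1 := h1 i
      have a2 := h2 i
      have a3 := h3 i
      rw [jdtPath, hE] at a2 a3
      dsimp only at a2 a3
      omega
    · have e : rowCount (delta T) (m + 1) = rowCount T m := by
        funext i
        have a2 := h2 i
        have a3 := h3 i
        omega
      rw [e]
      rw [jdtPath, hS] at h3 hv hu
      dsimp only at h3
      refine localRule_of_below (b := (jdtPath T K).1) (hT.antitone_rowCount _) ?_ ?_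
        (fun i => (h3 i).symm) h1
      · refine lt_of_lt_of_le ?_ hR
        refine lt_of_lt_of_le ?_ hT.length_le
        by_contra hge
        rw [IsCell, rowLen, List.getD_eq_default _ _ (not_lt.1 hge)] at hu
        simp at hu
      · have b1 := hT.lt_rowCount m (jdtPath T K).1 (jdtPath T K).2
        have b2 := hT.lt_rowCount m (jdtPath T K).1 ((jdtPath T K).2 + 1)
        have b3 := hT.lt_rowCount m ((jdtPath T K).1 + 1) (jdtPath T K).2
        have b4 := hT.lt_rowCount (m + 1) ((jdtPath T K).1 + 1) (jdtPath T K).2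
        have b5 := h3 ((jdtPath T K).1 + 1)
        have c1 := b1.2 ⟨hT.isCell_jdtPath hkn K, hK.val_le⟩
        have c2 := b4.2 ⟨hu, hv.le⟩
        have c3 : ¬ (jdtPath T K).2 + 1 < rowCount T m (jdtPath T K).1 := fun h => by
          have := hK.lt_val_right hL (b2.1 h).1
          have := (b2.1 h).2
          omega
        have c4 : ¬ (jdtPath T K).2 < rowCount T m ((jdtPath T K).1 + 1) := fun h => by
          have := (b3.1 h).2
          omega
        simp only [if_true] at b5
        omega

end Chain

/-! ## Rectangular tableaux and their iterated slides -/

section Rectangle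

variable {r c : ℕ} {P Q : ℕ → ℕ → ℕ}

theorem IsSYT.row_lt (hQ : IsSYT r c Q) {i a b : ℕ} (hi : i < r) (hab : a < b) (hb : b < c) :
    Q i a < Q i b := by
  induction b, hab using Nat.le_induction with
  | base => exact hQ.1 i a hi hb
  | succ b _ ih => exact (ih (by omega)).trans (hQ.1 i b hi hb)

theorem IsSYT.col_lt (hQ : IsSYT r c Q) {a b j : ℕ} (hj : j < c) (hab : a < b) (hb : b < r) :
    Q a j < Q b j := by
  induction b, hab using Nat.le_induction with
  | base => exact hQ.2.1 a j hb hj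
  | succ b _ ih => exact (ih (by omega)).trans (hQ.2.1 b j hb hj)

theorem IsSYT.mem_Icc (hQ : IsSYT r c Q) {i j : ℕ} (hi : i < r) (hj : j < c) :
    1 ≤ Q i j ∧ Q i j ≤ r * c :=
  hQ.2.2.mapsTo (show ((i, j) : ℕ × ℕ) ∈ {p : ℕ × ℕ | p.1 < r ∧ p.2 < c} from ⟨hi, hj⟩)

theorem IsSYT.exists_eq (hQ : IsSYT r c Q) {v : ℕ} (h1 : 1 ≤ v) (h2 : v ≤ r * c) :
    ∃ i j, i < r ∧ j < c ∧ Q i j = v := by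
  obtain ⟨p, hp, h⟩ := hQ.2.2.surjOn (show v ∈ Set.Icc 1 (r * c) from ⟨h1, h2⟩)
  exact ⟨p.1, p.2, hp.1, hp.2, h⟩

theorem IsSYT.eq_of_eq (hQ : IsSYT r c Q) {i j i' j' : ℕ} (hi : i < r) (hj : j < c)
    (hi' : i' < r) (hj' : j' < c) (h : Q i j = Q i' j') : (i, j) = (i', j') :=
  hQ.2.2.injOn (show ((i, j) : ℕ × ℕ) ∈ {p : ℕ × ℕ | p.1 < r ∧ p.2 < c} from ⟨hi, hj⟩)
    (show ((i', j') : ℕ × ℕ) ∈ {p : ℕ × ℕ | p.1 < r ∧ p.2 < c} from ⟨hi', hj'⟩) h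

theorem getD_toListT (i : ℕ) :
    (toListT r c P).getD i [] = if i < r then (List.range c).map fun j => P i j else [] := by
  by_cases h : i < r <;> simp [toListT, List.getD, h]

theorem rowLen_toListT (i : ℕ) : rowLen (toListT r c P) i = if i < r then c else 0 := by
  rw [rowLen, getD_toListT]
  split_ifs <;> simp

theorem isCell_toListT (p : ℕ × ℕ) : IsCell (toListT r c P) p ↔ p.1 < r ∧ p.2 < c := by
  rw [IsCell, rowLen_toListT]
  split_ifs with h <;> simp [h]

theorem val_toListT {p : ℕ × ℕ} (hp : p.1 < r ∧ p.2 < c) :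
    val (toListT r c P) p = P p.1 p.2 := by
  rw [val, entryL, getD_toListT, if_pos hp.1, getD_map_range, if_pos hp.2]

theorem length_flatten_toListT : (toListT r c P).flatten.length = r * c := by
  rw [List.length_flatten, toListT, List.map_map, sum_map_range]
  simp

theorem isStandard_toListT (hP : IsSYT r c P) :
    IsStandard r 0 (r * c) (toListT r c P) := by
  constructor
  · simp [toListT]
  · intro i j hij
    rw [rowLen_toListT, rowLen_toListT]
    split_ifs <;> omega
  · intro i j h
    rw [isCell_toListT] at h
    rw [val_toListT (p := (i, j)) ⟨h.1, (Nat.lt_succ_self j).trans h.2⟩, val_toListT h]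
    exact hP.1 i j h.1 h.2
  · intro i j h
    rw [isCell_toListT] at h
    rw [val_toListT (p := (i, j)) ⟨(Nat.lt_succ_self i).trans h.1, h.2⟩, val_toListT h]
    exact hP.2.1 i j h.1 h.2
  · intro p q hp hq h
    rw [isCell_toListT] at hp hq
    rw [val_toListT hp, val_toListT hq] at h
    exact hP.eq_of_eq hp.1 hp.2 hq.1 hq.2 h
  · intro p hp
    rw [isCell_toListT] at hp
    rw [val_toListT hp]
    exact hP.mem_Icc hp.1 hp.2
  · intro v hv hv'
    obtain ⟨i, j, hi, hj, h⟩ := hP.exists_eq hv hv'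
    exact ⟨(i, j), (isCell_toListT _).2 ⟨hi, hj⟩, by rw [val_toListT ⟨hi, hj⟩, h]⟩
  · rw [length_flatten_toListT, Nat.add_zero]

/-- The tableau `P` after `k` deletions of the minimal entry. -/
def slides (r c : ℕ) (P : ℕ → ℕ → ℕ) (k : ℕ) : List (List ℕ) := delta^[k] (toListT r c P)

theorem slides_succ (k : ℕ) : slides r c P (k + 1) = delta (slides r c P k) :=
  Function.iterate_succ_apply' _ _ _

theorem isStandard_slides (hP : IsSYT r c P) {k : ℕ} (hk : k ≤ r * c) :
    IsStandard r k (r * c) (slides r c P k) := by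
  induction k with
  | zero => exact isStandard_toListT hP
  | succ k ih =>
    rw [slides_succ]
    exact (ih (by omega)).slide hk

theorem isCell_slides_succ (hP : IsSYT r c P) {k : ℕ} (hk : k < r * c) (p : ℕ × ℕ) :
    IsCell (slides r c P (k + 1)) p ↔
      IsCell (slides r c P k) p ∧ p ≠ vacated (slides r c P k) := by
  rw [slides_succ]
  exact (isStandard_slides hP hk.le).isCell_delta hk p

theorem isCell_slides_anti (hP : IsSYT r c P) {k l : ℕ} (hkl : k ≤ l) (hl : l ≤ r * c)
    {p : ℕ × ℕ} (hp : IsCell (slides r c P l) p) : IsCell (slides r c P k) p := by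
  induction l, hkl using Nat.le_induction with
  | base => exact hp
  | succ l _ ih => exact ih (by omega) ((isCell_slides_succ hP hl p).1 hp).1

theorem isCell_vacated (hP : IsSYT r c P) {k : ℕ} (hk : k < r * c) :
    IsCell (slides r c P k) (vacated (slides r c P k)) := by
  rw [IsCell, ((isStandard_slides hP hk.le).vacated_snd hk).1]
  exact Nat.lt_succ_self _

theorem isCell_slides_lt (hP : IsSYT r c P) {k : ℕ} (hk : k ≤ r * c) {p : ℕ × ℕ}
    (hp : IsCell (slides r c P k) p) : p.1 < r ∧ p.2 < c :=
  (isCell_toListT p).1 (isCell_slides_anti hP (Nat.zero_le k) hk hp)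

theorem rowLen_slides_le (hP : IsSYT r c P) {k : ℕ} (hk : k ≤ r * c) (i : ℕ) :
    rowLen (slides r c P k) i ≤ c := by
  by_contra h
  have := (isCell_slides_lt hP hk (p := (i, c)) (not_le.1 h)).2
  simp at this

theorem vacated_slides_inj (hP : IsSYT r c P) {k l : ℕ} (hk : k < r * c) (hl : l < r * c)
    (h : vacated (slides r c P k) = vacated (slides r c P l)) : k = l := by
  have aux : ∀ k l, k < l → l < r * c →
      vacated (slides r c P k) ≠ vacated (slides r c P l) := by
    intro k l hkl hl h
    have h1 := isCell_slides_anti hP (Nat.succ_le_of_lt hkl) hl.le (isCell_vacated hP hl)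
    exact ((isCell_slides_succ hP (hkl.trans hl) _).1 h1).2 h.symm
  rcases lt_trichotomy k l with h' | h' | h'
  · exact absurd h (aux k l h' hl)
  · exact h'
  · exact absurd h.symm (aux l k h' hk)

theorem exists_vacated_slides (hP : IsSYT r c P) {p : ℕ × ℕ} (hp : p.1 < r ∧ p.2 < c) :
    ∃ k < r * c, vacated (slides r c P k) = p := by
  by_contra! hno
  have : ∀ m ≤ r * c, IsCell (slides r c P m) p := by
    intro m
    induction m with
    | zero => exact fun _ => (isCell_toListT p).2 hp
    | succ m ih =>
      exact fun hm => (isCell_slides_succ hP hm p).2 ⟨ih (by omega), (hno m hm).symm⟩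
  have := (isStandard_slides hP le_rfl).range p (this _ le_rfl)
  omega

theorem entryL_evacL (hP : IsSYT r c P) {k : ℕ} (hk : k < r * c) :
    entryL (evacL (toListT r c P)) (vacated (slides r c P k)).1
      (vacated (slides r c P k)).2 = r * c - k := by
  have hv := isCell_slides_lt hP hk.le (isCell_vacated hP hk)
  have e : entryL (evacL (toListT r c P)) (vacated (slides r c P k)).1
      (vacated (slides r c P k)).2 =
      evacEntry (toListT r c P) (vacated (slides r c P k)).1 (vacated (slides r c P k)).2 := by
    have hlen : (toListT r c P).length = r := by simp [toListT]
    rw [entryL, evacL, hlen, List.getD_eq_getElem _ ([] : List ℕ) (by simpa using hv.1),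
      List.getElem_map, List.getElem_range, getD_map_range, if_pos]
    have := (isCell_toListT (P := P) _).2 hv
    exact this
  rw [e, evacEntry, length_flatten_toListT]
  split
  · rename_i l hl
    have h1 := List.find?_some hl
    have h2 := List.mem_range.1 (List.mem_of_find?_eq_some hl)
    simp only [Prod.mk.eta, decide_eq_true_eq] at h1
    rw [vacated_slides_inj hP h2 hk h1]
  · rename_i hl
    have h1 := List.find?_eq_none.1 hl k (List.mem_range.2 hk)
    simp only [Prod.mk.eta, decide_eq_true_eq] at h1
    exact absurd rfl h1

/-! ## The promotion–evacuation diagram of a stacked tableau -/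

theorem stack_of_lt {i : ℕ} (hi : i < r) (j : ℕ) : stack r c P Q i j = P i j := if_pos hi

theorem stack_of_le {i : ℕ} (hi : r ≤ i) (j : ℕ) :
    stack r c P Q i j = Q (i - r) j + r * c := if_neg (not_lt.2 hi)

theorem PErow_left (hP : IsSYT r c P) (hQ : IsSYT r c Q) {k x : ℕ} (hk : k ≤ r * c)
    (hx : x ≤ r * c) :
    PErow (2 * r) c (stack r c P Q) k x =
      (List.range (2 * r)).map (rowCount (slides r c P k) x) := by
  induction k generalizing x with
  | zero =>
    apply List.map_congr_left
    intro i hi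
    rw [List.mem_range] at hi
    have hmin : min x (2 * r * c) = x := min_eq_left (by nlinarith)
    rw [hmin, rowCount]
    change _ = ((Finset.range (rowLen (toListT r c P) i)).filter
      fun j => val (toListT r c P) (i, j) ≤ x).card
    rw [rowLen_toListT]
    by_cases hir : i < r
    · rw [if_pos hir]
      congr 1
      apply Finset.filter_congr
      intro j hj
      rw [Finset.mem_range] at hj
      rw [stack_of_lt hir, val_toListT ⟨hir, hj⟩]
    · rw [if_neg hir]
      rw [Finset.range_zero, Finset.filter_empty, Finset.card_empty,
        Finset.card_eq_zero, Finset.filter_eq_empty_iff]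
      intro j hj
      rw [Finset.mem_range] at hj
      rw [stack_of_le (not_lt.1 hir)]
      have := hQ.mem_Icc (show i - r < r by omega) hj
      omega
  | succ k ih =>
    have hstd := isStandard_slides hP hk
    have hstd' := isStandard_slides hP (show k ≤ r * c by omega)
    have hzero : ∀ x ≤ k + 1, (List.range (2 * r)).map (rowCount (slides r c P (k + 1)) x) =
        List.replicate (2 * r) 0 := by
      intro x hx
      rw [List.map_congr_left (g := fun _ => 0) fun i _ => hstd.rowCount_eq_zero hx i]
      simp
    change nextRow (2 * r) (PErow (2 * r) c (stack r c P Q) k) (k + 1) x = _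
    induction x with
    | zero => rw [hzero 0 (by omega)]; rfl
    | succ x ihx =>
      rw [nextRow]
      split_ifs with h
      · rw [hzero _ h]
      · rw [ihx (by omega), ih (by omega) (by omega), ih (by omega) hx, slides_succ]
        exact hstd'.localRule_rowCount hk (by omega) (by omega)

end Rectangle

/-! ## Vertical sums of columns -/

/-- The row lengths of the partition in `c` columns of heights `H`. -/
def rowsOf (c : ℕ) (H : ℕ → ℕ) (i : ℕ) : ℕ := ((Finset.range c).filter fun j => i < H j).card

theorem rowsOf_congr {c : ℕ} {H H' : ℕ → ℕ} (h : ∀ j < c, H j = H' j) :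
    rowsOf c H = rowsOf c H' := by
  funext i
  unfold rowsOf
  congr 1
  apply Finset.filter_congr
  intro j hj
  rw [h j (Finset.mem_range.1 hj)]

theorem antitone_rowsOf (c : ℕ) (H : ℕ → ℕ) : Antitone (rowsOf c H) := fun _ _ hab =>
  Finset.card_le_card (Finset.monotone_filter_right _ fun _ _ h => lt_of_le_of_lt hab h)

theorem rowsOf_add {c j₀ : ℕ} {H H' : ℕ → ℕ} (hj : j₀ < c)
    (h : ∀ j < c, H' j = H j + if j = j₀ then 1 else 0) (i : ℕ) :
    rowsOf c H' i = rowsOf c H i + if i = H j₀ then 1 else 0 := by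
  have e : (if i = H j₀ then 1 else 0) =
      ∑ j ∈ Finset.range c, if j = j₀ then (if i = H j₀ then 1 else 0) else 0 := by
    simp [hj]
  unfold rowsOf
  rw [e, Finset.card_filter, Finset.card_filter, ← Finset.sum_add_distrib]
  apply Finset.sum_congr rfl
  intro j hj
  have := h j (Finset.mem_range.1 hj)
  by_cases hjj : j = j₀
  · subst hjj
    simp only [if_true] at this ⊢
    split_ifs <;> omega
  · simp only [hjj, if_false, Nat.add_zero] at this ⊢
    rw [this]

/-- The local rule for vertical sums: adding a cell to column `u` of `q` and removing a cell
from column `v` of `p`. -/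
theorem localRule_vertical_sum {c R u v : ℕ} {q q' p p' : ℕ → ℕ} (hu : u < c) (hv : v < c)
    (hq : ∀ j < c, q' j = q j + if j = u then 1 else 0)
    (hp : ∀ j < c, p j = p' j + if j = v then 1 else 0)
    (aq : AntitoneOn q (Set.Iio c)) (aq' : AntitoneOn q' (Set.Iio c))
    (ap : AntitoneOn p (Set.Iio c)) (ap' : AntitoneOn p' (Set.Iio c))
    (hR : q' u + p u ≤ R) :
    localRule ((List.range R).map (rowsOf c (q + p))) ((List.range R).map (rowsOf c (q' + p)))
        ((List.range R).map (rowsOf c (q + p'))) =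
        (List.range R).map (rowsOf c (q' + p')) ∧
      decoration ((List.range R).map (rowsOf c (q + p)))
        ((List.range R).map (rowsOf c (q' + p))) ((List.range R).map (rowsOf c (q + p'))) =
        if u = v then q u + p u else 0 := by
  have hnu := rowsOf_add (H := q + p) (H' := q' + p) hu fun j hj => by
    simp only [Pi.add_apply, hq j hj]; ring
  have hka := rowsOf_add (H := q + p') (H' := q + p) hv fun j hj => by
    simp only [Pi.add_apply, hp j hj]; ring
  by_cases huv : u = v
  · subst huv
    have hpu := hp u hu
    have hqu := hq u hu
    simp only [if_true] at hpu hqu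
    have hmu : rowsOf c (q' + p') = rowsOf c (q + p) := rowsOf_congr fun j hj => by
      simp only [Pi.add_apply, hp j hj, hq j hj]; ring
    have hstep : rowsOf c (q + p) (q u + p' u) = rowsOf c (q + p) (q u + p' u + 1) + 1 := by
      have e : (Finset.range c).filter (fun j => q u + p' u < (q + p) j) =
          insert u ((Finset.range c).filter fun j => q u + p' u + 1 < (q + p) j) := by
        ext j
        simp only [Finset.mem_filter, Finset.mem_range, Finset.mem_insert, Pi.add_apply]
        constructor
        · rintro ⟨hj, hlt⟩
          by_cases hju : j = u
          · exact Or.inl hju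
          refine Or.inr ⟨hj, ?_⟩
          have e1 := hq j hj
          have e2 := hp j hj
          simp only [hju, if_false] at e1 e2
          rcases lt_or_gt_of_ne hju with h | h
          · have := aq' (Set.mem_Iio.2 hj) (Set.mem_Iio.2 hu) h.le
            have := ap (Set.mem_Iio.2 hj) (Set.mem_Iio.2 hu) h.le
            omega
          · have := aq (Set.mem_Iio.2 hu) (Set.mem_Iio.2 hj) h.le
            have := ap' (Set.mem_Iio.2 hu) (Set.mem_Iio.2 hj) h.le
            omega
        · rintro (rfl | ⟨hj, hlt⟩)
          · exact ⟨hu, by omega⟩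
          · exact ⟨hj, by omega⟩
      unfold rowsOf
      rw [e, Finset.card_insert_of_notMem]
      simp only [Finset.mem_filter, Pi.add_apply, not_and]
      omega
    have hnu' : ∀ i, rowsOf c (q' + p) i =
        rowsOf c (q + p) i + if i = q u + p' u + 1 then 1 else 0 := by
      intro i
      rw [hnu i, Pi.add_apply, hpu, Nat.add_assoc]
    rw [hmu]
    refine ⟨localRule_of_below (antitone_rowsOf _ _) (by omega) hstep hnu'
      fun i => (hka i).symm, ?_⟩
    rw [decoration_of_below (antitone_rowsOf _ _) (by omega) hstep hnu'
      fun i => (hka i).symm, if_pos rfl, hpu, Nat.add_assoc]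
  · have hmu := rowsOf_add (H := q' + p') (H' := q' + p) hv fun j hj => by
      simp only [Pi.add_apply, hp j hj]; ring
    have hqv := hq v hv
    rw [if_neg (Ne.symm huv)] at hqv
    have h : ∀ i < R, rowsOf c (q' + p') i + rowsOf c (q + p) i =
        rowsOf c (q' + p) i + rowsOf c (q + p') i := by
      intro i _
      rw [hka i, hmu i]
      simp only [Pi.add_apply, hqv, Nat.add_zero]
      omega
    rw [if_neg huv]
    exact ⟨localRule_of_antitone (antitone_rowsOf _ _) h,
      decoration_of_antitone (antitone_rowsOf _ _) h⟩

section Block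

variable {r c : ℕ} {P Q : ℕ → ℕ → ℕ}

/-- The height of column `j` of the shape of the `k`-th slide of `P`. -/
def colLen (r c : ℕ) (P : ℕ → ℕ → ℕ) (k j : ℕ) : ℕ :=
  ((Finset.range r).filter fun i => j < rowLen (slides r c P k) i).card

/-- The number of entries of column `j` of `Q` that are at most `x`. -/
def colCount (r : ℕ) (Q : ℕ → ℕ → ℕ) (x j : ℕ) : ℕ :=
  ((Finset.range r).filter fun i => Q i j ≤ x).card

theorem lt_colLen (hP : IsSYT r c P) {k : ℕ} (hk : k ≤ r * c) (i j : ℕ) :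
    i < colLen r c P k j ↔ IsCell (slides r c P k) (i, j) := by
  unfold colLen
  rw [lt_card_filter_range]
  · exact and_iff_right_of_imp fun h => (isCell_slides_lt hP hk (p := (i, j)) h).1
  · intro a b hab _ h
    exact lt_of_lt_of_le h ((isStandard_slides hP hk).anti hab.le)

theorem lt_colCount (hQ : IsSYT r c Q) {x i j : ℕ} (hj : j < c) :
    i < colCount r Q x j ↔ i < r ∧ Q i j ≤ x := by
  unfold colCount
  rw [lt_card_filter_range]
  intro a b hab hb h
  exact (hQ.col_lt hj hab hb).le.trans h

theorem colLen_le (k j : ℕ) : colLen r c P k j ≤ r :=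
  (Finset.card_filter_le _ _).trans (Finset.card_range r).le

theorem colCount_le (x j : ℕ) : colCount r Q x j ≤ r :=
  (Finset.card_filter_le _ _).trans (Finset.card_range r).le

theorem antitone_colLen (k : ℕ) : Antitone (colLen r c P k) := fun _ _ hab =>
  Finset.card_le_card (Finset.monotone_filter_right _ fun _ _ h => lt_of_le_of_lt hab h)

theorem antitoneOn_colCount (hQ : IsSYT r c Q) (x : ℕ) :
    AntitoneOn (colCount r Q x) (Set.Iio c) := by
  intro a _ b hb hab
  rcases hab.eq_or_lt with rfl | hlt
  · rfl
  · refine Finset.card_le_card fun i => ?_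
    simp only [Finset.mem_filter, Finset.mem_range]
    exact fun h => ⟨h.1, (hQ.row_lt h.1 hlt hb).le.trans h.2⟩

theorem eq_succ_of_lt_iff {a a' u : ℕ} (h : ∀ i, i < a' ↔ i < a ∧ i ≠ u) (hu : u < a) :
    a = a' + 1 ∧ a' = u := by
  have h2 := h u
  have h3 := h a'
  have h4 := h (a - 1)
  have h6 := h (u + 1)
  have h7 := h (a' - 1)
  have h8 := h (a' + 1)
  omega

theorem eq_of_lt_iff {a a' : ℕ} (h : ∀ i, i < a' ↔ i < a) : a = a' := by
  have h3 := h a'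
  have h4 := h a
  omega

theorem colLen_slide (hP : IsSYT r c P) {k : ℕ} (hk : k < r * c) :
    (∀ j, colLen r c P k j =
      colLen r c P (k + 1) j + if j = (vacated (slides r c P k)).2 then 1 else 0) ∧
    colLen r c P k (vacated (slides r c P k)).2 = (vacated (slides r c P k)).1 + 1 := by
  have key : ∀ i j, i < colLen r c P (k + 1) j ↔
      i < colLen r c P k j ∧ (i, j) ≠ vacated (slides r c P k) := fun i j => by
    rw [lt_colLen hP hk, lt_colLen hP hk.le, isCell_slides_succ hP hk]
  have hv := (lt_colLen hP hk.le _ _).2 (isCell_vacated hP hk)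
  have h1 := eq_succ_of_lt_iff (a := colLen r c P k (vacated (slides r c P k)).2)
    (a' := colLen r c P (k + 1) (vacated (slides r c P k)).2)
    (u := (vacated (slides r c P k)).1) (fun i => by
      rw [key i, Ne, Ne, Prod.ext_iff]
      simp only [and_true]) hv
  refine ⟨fun j => ?_, by omega⟩
  by_cases hj : j = (vacated (slides r c P k)).2
  · subst hj
    simpa using h1.1
  · rw [if_neg hj, Nat.add_zero]
    refine eq_of_lt_iff fun i => ?_
    rw [key i]
    exact and_iff_left fun e => hj (by rw [← e])

theorem colCount_succ (hQ : IsSYT r c Q) {x i₀ j₀ : ℕ} (hi : i₀ < r) (hj : j₀ < c)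
    (h : Q i₀ j₀ = x + 1) :
    (∀ j < c, colCount r Q (x + 1) j = colCount r Q x j + if j = j₀ then 1 else 0) ∧
    colCount r Q x j₀ = i₀ := by
  have key : ∀ i, ∀ j < c, (i < colCount r Q x j ↔
      i < colCount r Q (x + 1) j ∧ (i, j) ≠ (i₀, j₀)) := fun i j hjc => by
    rw [lt_colCount hQ hjc, lt_colCount hQ hjc, and_assoc]
    refine and_congr_right fun hir => ?_
    constructor
    · refine fun hle => ⟨by omega, fun e => ?_⟩
      simp only [Prod.mk.injEq] at e
      rw [e.1, e.2] at hle
      omega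
    · rintro ⟨hle, hne⟩
      have : Q i j ≠ x + 1 := fun e => hne (hQ.eq_of_eq hir hjc hi hj (e.trans h.symm))
      omega
  have hv := (lt_colCount hQ hj).2 ⟨hi, h.le⟩
  have h1 := eq_succ_of_lt_iff (fun i => by
    rw [key i _ hj, Ne, Ne, Prod.ext_iff]
    simp only [and_true]) hv
  refine ⟨fun j hjc => ?_, h1.2⟩
  by_cases hjj : j = j₀
  · subst hjj
    simpa using h1.1
  · rw [if_neg hjj, Nat.add_zero (colCount r Q x j)]
    refine eq_of_lt_iff fun i => ?_
    rw [key i j hjc]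
    refine and_iff_left fun e => hjj ?_
    simp only [Prod.mk.injEq] at e
    exact e.2

/-- The decoration and local rule of the square of the northeast block whose added and
removed cells lie in the columns of `x + 1` in `Q` and of the `k`-th vacated cell of `P`. -/
theorem localRule_block (hP : IsSYT r c P) (hQ : IsSYT r c Q) {k x i₀ j₀ : ℕ}
    (hk : k < r * c) (hi : i₀ < r) (hj : j₀ < c) (h : Q i₀ j₀ = x + 1) :
    let V := fun x k => (List.range (2 * r)).map
      (rowsOf c (colCount r Q x + colLen r c P k))
    localRule (V x k) (V (x + 1) k) (V x (k + 1)) = V (x + 1) (k + 1) ∧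
      decoration (V x k) (V (x + 1) k) (V x (k + 1)) =
        if j₀ = (vacated (slides r c P k)).2 then i₀ + (vacated (slides r c P k)).1 + 1
        else 0 := by
  intro V
  have hp := colLen_slide hP hk
  have hq := colCount_succ hQ hi hj h
  have hv := isCell_slides_lt hP hk.le (isCell_vacated hP hk)
  have hR : colCount r Q (x + 1) j₀ + colLen r c P k j₀ ≤ 2 * r := by
    have := colCount_le (r := r) (Q := Q) (x + 1) j₀
    have := colLen_le (r := r) (c := c) (P := P) k j₀
    omega
  have main := localRule_vertical_sum hj hv.2 hq.1 (fun j _ => hp.1 j)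
    (antitoneOn_colCount hQ _) (antitoneOn_colCount hQ _)
    ((antitone_colLen _).antitoneOn _) ((antitone_colLen _).antitoneOn _) hR
  refine ⟨main.1, main.2.trans ?_⟩
  split_ifs with e
  · rw [hq.2, e, hp.2]
    ring
  · rfl

/-- The northeast block of the diagram consists of vertical sums. -/
theorem PErow_right (hP : IsSYT r c P) (hQ : IsSYT r c Q) {k x : ℕ} (hk : k ≤ r * c)
    (hx : x ≤ r * c) :
    PErow (2 * r) c (stack r c P Q) k (r * c + x) =
      (List.range (2 * r)).map (rowsOf c (colCount r Q x + colLen r c P k)) := by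
  induction k generalizing x with
  | zero =>
    apply List.map_congr_left
    intro i hi
    rw [List.mem_range] at hi
    have hmin : min (r * c + x) (2 * r * c) = r * c + x := min_eq_left (by nlinarith)
    rw [hmin, rowsOf]
    congr 1
    apply Finset.filter_congr
    intro j hj
    rw [Finset.mem_range] at hj
    have hr : colLen r c P 0 j = r := card_filter_range_eq le_rfl fun i hi => by
      have : j < rowLen (slides r c P 0) i := (isCell_toListT (i, j)).2 ⟨hi, hj⟩
      simp [this, hi]
    rw [Pi.add_apply, hr]
    by_cases hir : i < r
    · rw [stack_of_lt hir]
      have := hP.mem_Icc hir hj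
      exact iff_of_true (by omega) (by omega)
    · rw [stack_of_le (not_lt.1 hir)]
      have := lt_colCount hQ (x := x) (i := i - r) hj
      omega
  | succ k ih =>
    induction x with
    | zero =>
      change PErow (2 * r) c (stack r c P Q) (k + 1) (r * c) = _
      rw [PErow_left hP hQ hk le_rfl]
      apply List.map_congr_left
      intro i _
      rw [(isStandard_slides hP hk).rowCount_top]
      refine (card_filter_range_eq (rowLen_slides_le hP hk i) fun j hj => ?_).symm
      have h0 : colCount r Q 0 j = 0 := by
        by_contra h
        have h1 := (lt_colCount hQ hj).1 (Nat.pos_of_ne_zero h)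
        have := hQ.mem_Icc h1.1 hj
        omega
      rw [Pi.add_apply, h0, Nat.zero_add, lt_colLen hP hk]
      rfl
    | succ x ihx =>
      obtain ⟨i₀, j₀, hi, hj, h⟩ := hQ.exists_eq (v := x + 1) (by omega) hx
      have hb := (localRule_block hP hQ hk hi hj h).1
      dsimp only at hb
      rw [← hb, ← ih (by omega) hx,
        ← ih (by omega) (by omega), ← ihx (by omega)]
      change nextRow (2 * r) (PErow (2 * r) c (stack r c P Q) k) (k + 1) (r * c + x + 1) = _
      rw [nextRow, if_neg (by omega)]
      rfl

theorem PMNE_eq (hP : IsSYT r c P) (hQ : IsSYT r c Q) {k i j : ℕ} (hk : k < r * c)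
    (hi : i < r) (hj : j < c) :
    PMNE r c (stack r c P Q) (Q i j) (r * c - k) =
      if j = (vacated (slides r c P k)).2 then i + (vacated (slides r c P k)).1 + 1 else 0 := by
  have hm := hQ.mem_Icc hi hj
  obtain ⟨x, hx⟩ : ∃ x, Q i j = x + 1 := ⟨Q i j - 1, by omega⟩
  have hb := (localRule_block hP hQ hk hi hj hx).2
  dsimp only at hb
  rw [← hb, PMNE]
  have e1 : r * c - (r * c - k) = k := by omega
  have e2 : r * c - (r * c - k - 1) = k + 1 := by omega
  simp only [lamBlock, e1, e2, hx, Nat.add_sub_cancel]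
  rw [PErow_right hP hQ hk.le (by omega), PErow_right hP hQ hk.le (by omega),
    PErow_right hP hQ hk (by omega)]

end Block

/-- For `P, Q ∈ SYT(r × c)`, `n = rc`, `S = stack(P, Q)`, with `x_{ij}`
the entries of `Q` and `y_{ij}` the entries of `∂(P)`: for all `1 ≤ s, t ≤ r` and
`1 ≤ j ≤ c` the entry of `PM(S)^NE` at Cartesian coordinates `(x_{sj}, y_{tj})` equals
`s + t - 1`; moreover every nonzero entry of `PM(S)^NE` occurs at such a position. -/
theorem PMNE_entry_eq (r c : ℕ) (P Q : ℕ → ℕ → ℕ)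
    (hP : IsSYT r c P) (hQ : IsSYT r c Q) :
    (∀ s t j : ℕ, 1 ≤ s → s ≤ r → 1 ≤ t → t ≤ r → 1 ≤ j → j ≤ c →
      PMNE r c (stack r c P Q) (Q (s - 1) (j - 1))
        (entryL (evacL (toListT r c P)) (t - 1) (j - 1)) = s + t - 1) ∧
    (∀ x y : ℕ, 1 ≤ x → x ≤ r * c → 1 ≤ y → y ≤ r * c →
      PMNE r c (stack r c P Q) x y ≠ 0 →
      ∃ s t j : ℕ, 1 ≤ s ∧ s ≤ r ∧ 1 ≤ t ∧ t ≤ r ∧ 1 ≤ j ∧ j ≤ c ∧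
        x = Q (s - 1) (j - 1) ∧
        y = entryL (evacL (toListT r c P)) (t - 1) (j - 1)) := by


  constructor
  · intro s t j hs hs' ht ht' hj hj'
    obtain ⟨k, hk, hv⟩ := exists_vacated_slides hP (p := (t - 1, j - 1))
      ⟨by simp only; omega, by simp only; omega⟩
    have hy := entryL_evacL hP hk
    rw [hv] at hy
    rw [hy, PMNE_eq hP hQ hk (by omega) (by omega), hv, if_pos rfl]
    simp only
    omega
  · intro x y hx hx' hy hy' hne
    obtain ⟨i, j, hi, hj, rfl⟩ := hQ.exists_eq hx hx'
    obtain ⟨k, hk, rfl⟩ : ∃ k < r * c, y = r * c - k := ⟨r * c - y, by omega, by omega⟩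
    rw [PMNE_eq hP hQ hk hi hj] at hne
    have hjv : j = (vacated (slides r c P k)).2 := by
      by_contra h
      exact hne (if_neg h)
    have hv := isCell_slides_lt hP hk.le (isCell_vacated hP hk)
    refine ⟨i + 1, (vacated (slides r c P k)).1 + 1, j + 1, by omega, hi, by omega, hv.1,
      by omega, hj, rfl, ?_⟩
    simp only [Nat.add_sub_cancel]
    rw [hjv, entryL_evacL hP hk]

end PromRS
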